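/- Let a ≥ 0, b ≥ 1 and let E ⊆ ⋃_{n≥1} B_n^{a,b} be a stable set. The following are equivalent: (i) for every 1 < p < ∞, lim_n n^{1/p − 1}·τ_{p,n}(E) = 0; (ii) for some 1 < p < ∞, lim_n n^{1/p − 1}·τ_{p,n}(E) = 0; (iii) lim_n Θ_n(E) = 0; (iv) for every ϱ > 0 there exists N ∈ ℕ such that for all n ≥ N, E ∩ B_n^{a,b} contains no ϱ-ℓ₁-sequence; (v) there does not exist c > 0 such that for every n ∈ ℕ the pair (r,ρ) with r(∑ a_i e_i) = ∑_{i=1}^n |a_i| and ρ(∑ a_i e_i) = c·∑_{i=1}^n |a_i| belongs to E ∩ B_n^{a,b} (i.e. c·Id_{ℓ₁} is not block finitely representable on E). -/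

import Mathlib

open scoped BigOperators ENNReal

noncomputable section

namespace AsymSeminorms

variable {𝕜 : Type*} [RCLike 𝕜]

/-- A pair of seminorms on `𝕜^n`, used to encode a (finite) basic sequence together with
the seminorm induced by an operator. -/
abbrev SNPair (𝕜 : Type*) [RCLike 𝕜] (n : ℕ) : Type _ :=
  Seminorm 𝕜 (Fin n → 𝕜) × Seminorm 𝕜 (Fin n → 𝕜)

/-- Truncation of a vector in `𝕜^n` to its first `m` coordinates (the rest set to `0`);
this encodes `∑_{i=1}^m a_i e_i`. -/
def trunc {n : ℕ} (m : ℕ) (a : Fin n → 𝕜) : Fin n → 𝕜 :=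
  fun i => if (i : ℕ) < m then a i else 0

/-- Membership in the set `B_n^{a,b}` (here the constants are called `ca`, `cb`):
`r = P.1` is a norm with `r(e_i) = 1`, both seminorms satisfy the `b`-basis inequality for
truncations, and `ρ = P.2` satisfies `ρ ≤ a·r`. -/
structure MemB (ca cb : ℝ) {n : ℕ} (P : SNPair 𝕜 n) : Prop where
  eq_zero_of : ∀ x : Fin n → 𝕜, P.1 x = 0 → x = 0
  single_eq_one : ∀ i : Fin n, P.1 (Pi.single i 1) = 1
  trunc_fst : ∀ m : ℕ, m ≤ n → ∀ a : Fin n → 𝕜, P.1 (trunc m a) ≤ cb * P.1 a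
  trunc_snd : ∀ m : ℕ, m ≤ n → ∀ a : Fin n → 𝕜, P.2 (trunc m a) ≤ cb * P.2 a
  snd_le : ∀ x : Fin n → 𝕜, P.2 x ≤ ca * P.1 x

/-- The metric `d_n` on `B_n^{a,b}`: the supremum, over coefficient vectors in the unit ball
of `ℓ_∞^n`, of the maximal deviation of the two seminorms. -/
def dB {n : ℕ} (P Q : SNPair 𝕜 n) : ℝ :=
  sSup {x : ℝ | ∃ a : Fin n → 𝕜, (∀ i, ‖a i‖ ≤ 1) ∧
      x = max |P.1 a - Q.1 a| |P.2 a - Q.2 a|}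

/-- A family `E`, with `E n` a set of pairs of seminorms on `𝕜^n`; this encodes a subset of
`⋃_{n≥1} B_n^{a,b}`. -/
abbrev Fam (𝕜 : Type*) [RCLike 𝕜] : Type _ := ∀ n : ℕ, Set (SNPair 𝕜 n)

/-- `E ⊆ ⋃_n B_n^{a,b}`. -/
def SubB (ca cb : ℝ) (E : Fam 𝕜) : Prop := ∀ n, ∀ P ∈ E n, MemB ca cb P

/-- `E` is closed: each `E ∩ B_n^{a,b}` is closed in `B_n^{a,b}` for the metric `d_n`. -/
def ClosedFam (ca cb : ℝ) (E : Fam 𝕜) : Prop :=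
  ∀ n, ∀ P : SNPair 𝕜 n, MemB ca cb P →
    (∀ ε : ℝ, 0 < ε → ∃ Q ∈ E n, dB P Q < ε) → P ∈ E n

/-- The `j`-th block piece: the vector `∑_{k_j < i ≤ k_{j+1}} a_i e_i` (with `0`-based
indexing of the cut points `k`). -/
def piece {n m : ℕ} (a : Fin n → 𝕜) (k : Fin (m + 1) → ℕ) (j : Fin m) : Fin n → 𝕜 :=
  fun i => if k j.castSucc ≤ (i : ℕ) ∧ (i : ℕ) < k j.succ then a i else 0

/-- `(s,σ) = Q` is a block of `(r,ρ) = P`. -/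
def IsBlockOf {n m : ℕ} (P : SNPair 𝕜 n) (Q : SNPair 𝕜 m) : Prop :=
  ∃ (a : Fin n → 𝕜) (k : Fin (m + 1) → ℕ),
    k 0 = 0 ∧ StrictMono k ∧ k (Fin.last m) ≤ n ∧
    (∀ j : Fin m, P.1 (piece a k j) = 1) ∧
    (∀ b : Fin m → 𝕜, Q.1 b = P.1 (∑ j : Fin m, b j • piece a k j)) ∧
    (∀ b : Fin m → 𝕜, Q.2 b = P.2 (∑ j : Fin m, b j • piece a k j))

/-- `E` contains all blocks of its members (that lie in the corresponding `B_m^{a,b}`). -/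
def BlockClosedFam (ca cb : ℝ) (E : Fam 𝕜) : Prop :=
  ∀ n m : ℕ, ∀ P ∈ E n, ∀ Q : SNPair 𝕜 m, MemB ca cb Q → IsBlockOf P Q → Q ∈ E m

/-- `E ⊆ ⋃_n B_n^{a,b}` is stable: closed and block closed. -/
def StableFam (ca cb : ℝ) (E : Fam 𝕜) : Prop :=
  SubB ca cb E ∧ ClosedFam ca cb E ∧ BlockClosedFam ca cb E

/-- `E` is an identity block: stable and `r = ρ` for each member. -/
def IdentityBlockFam (ca cb : ℝ) (E : Fam 𝕜) : Prop :=
  StableFam ca cb E ∧ ∀ n, ∀ P ∈ E n, P.1 = P.2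

/-- The `ℓ_p^n` norm of a coefficient vector, `1 ≤ p ≤ ∞`. -/
def lpnorm (p : ℝ≥0∞) {n : ℕ} (a : Fin n → 𝕜) : ℝ :=
  if p = ∞ then ⨆ i, ‖a i‖ else (∑ i, ‖a i‖ ^ p.toReal) ^ (1 / p.toReal)

/-- The sign `±1 ∈ 𝕜` associated to a Boolean. -/
def sgn (b : Bool) : 𝕜 := if b then 1 else -1

/-- The `L_p` norm of a real function of `n` independent Rademacher variables, i.e. of a
function on `{±1}^n` with the uniform probability measure. -/
def radLp (p : ℝ≥0∞) {n : ℕ} (F : (Fin n → Bool) → ℝ) : ℝ :=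
  if p = ∞ then ⨆ ε : Fin n → Bool, |F ε|
  else ((∑ ε : Fin n → Bool, |F ε| ^ p.toReal) / 2 ^ n) ^ (1 / p.toReal)

/-- `α_{p,n}(E)`: the infimum of the constants `T > 0` such that
`ρ(∑ a_i e_i) ≤ T ‖(a_i)‖_{ℓ_p^n}` for all `(r,ρ) ∈ E ∩ B_n^{a,b}`. -/
def alphaC (p : ℝ≥0∞) (E : Fam 𝕜) (n : ℕ) : ℝ :=
  sInf {T : ℝ | 0 < T ∧ ∀ P ∈ E n, ∀ a : Fin n → 𝕜, P.2 a ≤ T * lpnorm p a}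

/-- `β_{q,n}(E)`: the infimum of the constants `C > 0` such that
`C r(∑ a_i e_i) ≥ ‖(a_i ρ(e_i))‖_{ℓ_q^n}` for all `(r,ρ) ∈ E ∩ B_n^{a,b}`. -/
def betaC (q : ℝ≥0∞) (E : Fam 𝕜) (n : ℕ) : ℝ :=
  sInf {C : ℝ | 0 < C ∧ ∀ P ∈ E n, ∀ a : Fin n → 𝕜,
    lpnorm q (fun i => a i * ((P.2 (Pi.single i 1) : ℝ) : 𝕜)) ≤ C * P.1 a}

/-- `τ_{p,n}(E)`: the infimum of the constants `T > 0` such that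
`‖ρ(∑ ε_i a_i e_i)‖_{L_p} ≤ T ‖(a_i)‖_{ℓ_p^n}` for all `(r,ρ) ∈ E ∩ B_n^{a,b}`. -/
def tauC (p : ℝ≥0∞) (E : Fam 𝕜) (n : ℕ) : ℝ :=
  sInf {T : ℝ | 0 < T ∧ ∀ P ∈ E n, ∀ a : Fin n → 𝕜,
    radLp p (fun ε => P.2 (fun i => sgn (ε i) * a i)) ≤ T * lpnorm p a}

/-- `γ_{q,n}(E)`: the infimum of the constants `C > 0` such that
`C ‖r(∑ ε_i a_i e_i)‖_{L_q} ≥ ‖(a_i ρ(e_i))‖_{ℓ_q^n}` for all `(r,ρ) ∈ E ∩ B_n^{a,b}`. -/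
def gammaC (q : ℝ≥0∞) (E : Fam 𝕜) (n : ℕ) : ℝ :=
  sInf {C : ℝ | 0 < C ∧ ∀ P ∈ E n, ∀ a : Fin n → 𝕜,
    lpnorm q (fun i => a i * ((P.2 (Pi.single i 1) : ℝ) : 𝕜)) ≤
      C * radLp q (fun ε => P.1 (fun i => sgn (ε i) * a i))}

/-- `θ_n(E)`: the infimum of the constants `T > 0` such that
`ρ((1/n) ∑ a_i e_i) ≤ T ‖(a_i)‖_{ℓ_∞^n}` for all `(r,ρ) ∈ E ∩ B_n^{a,b}`. -/
def thetaC (E : Fam 𝕜) (n : ℕ) : ℝ :=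
  sInf {T : ℝ | 0 < T ∧ ∀ P ∈ E n, ∀ a : Fin n → 𝕜,
    P.2 ((n : 𝕜)⁻¹ • a) ≤ T * lpnorm ∞ a}

/-- `Θ_n(E)`: the infimum of the constants `T > 0` such that
`‖ρ((1/n) ∑ ε_i a_i e_i)‖_{L_1} ≤ T ‖(a_i)‖_{ℓ_∞^n}` for all `(r,ρ) ∈ E ∩ B_n^{a,b}`. -/
def bigThetaC (E : Fam 𝕜) (n : ℕ) : ℝ :=
  sInf {T : ℝ | 0 < T ∧ ∀ P ∈ E n, ∀ a : Fin n → 𝕜,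
    radLp 1 (fun ε => P.2 ((n : 𝕜)⁻¹ • fun i => sgn (ε i) * a i)) ≤ T * lpnorm ∞ a}

/-- `υ_n(E)`: the infimum of the constants `C > 0` such that
`C r(∑ a_i e_i) ≥ min_i |a_i| ρ(e_i)` for all `(r,ρ) ∈ E ∩ B_n^{a,b}`. -/
def upsC (E : Fam 𝕜) (n : ℕ) : ℝ :=
  sInf {C : ℝ | 0 < C ∧ ∀ P ∈ E n, ∀ a : Fin n → 𝕜,
    (⨅ i, ‖a i‖ * P.2 (Pi.single i 1)) ≤ C * P.1 a}

/-- `Υ_n(E)`: the infimum of the constants `C > 0` such that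
`C ‖r(∑ ε_i a_i e_i)‖_{L_1} ≥ min_i |a_i| ρ(e_i)` for all `(r,ρ) ∈ E ∩ B_n^{a,b}`. -/
def bigUpsC (E : Fam 𝕜) (n : ℕ) : ℝ :=
  sInf {C : ℝ | 0 < C ∧ ∀ P ∈ E n, ∀ a : Fin n → 𝕜,
    (⨅ i, ‖a i‖ * P.2 (Pi.single i 1)) ≤
      C * radLp 1 (fun ε => P.1 (fun i => sgn (ε i) * a i))}

end AsymSeminorms

namespace AsymSeminorms

/-- A `ϱ`-`ℓ₁`-sequence: `ρ(∑ a_i e_i) ≥ ϱ ∑ |a_i|` for all scalars `(a_i)`. -/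
def IsL1Seq {𝕜 : Type*} [RCLike 𝕜] (ϱ : ℝ) {n : ℕ} (P : SNPair 𝕜 n) : Prop :=
  ∀ a : Fin n → 𝕜, ϱ * ∑ i, ‖a i‖ ≤ P.2 a

section Blocks

variable {𝕜 : Type*} [RCLike 𝕜]

/-- The vectors `w j` are nonzero only on successive sets of coordinates. -/
def Successive {n m : ℕ} (w : Fin m → Fin n → 𝕜) : Prop :=
  ∀ j j', j < j' → ∀ i i', w j i ≠ 0 → w j' i' ≠ 0 → i < i'

/-- The vector `w` scaled so that `r w = 1` (when `r w ≠ 0`). -/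
def normalize {n : ℕ} (r : Seminorm 𝕜 (Fin n → 𝕜)) (w : Fin n → 𝕜) : Fin n → 𝕜 :=
  (((r w)⁻¹ : ℝ) : 𝕜) • w

lemma seminorm_ofReal_smul {n : ℕ} (q : Seminorm 𝕜 (Fin n → 𝕜)) {t : ℝ} (ht : 0 ≤ t)
    (w : Fin n → 𝕜) : q ((t : 𝕜) • w) = t * q w := by
  rw [map_smul_eq_mul, RCLike.norm_ofReal, abs_of_nonneg ht]

lemma seminorm_sum_le {n : ℕ} (q : Seminorm 𝕜 (Fin n → 𝕜)) {ι : Type*} (s : Finset ι)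
    (f : ι → Fin n → 𝕜) : q (∑ j ∈ s, f j) ≤ ∑ j ∈ s, q (f j) :=
  Finset.le_sum_of_subadditive q (map_zero q).le (map_add_le_add q) s f

lemma seminorm_le_sum_single {n : ℕ} (q : Seminorm 𝕜 (Fin n → 𝕜)) (a : Fin n → 𝕜) :
    q a ≤ ∑ i, ‖a i‖ * q (Pi.single i 1) := by
  have h : a = ∑ i, a i • (Pi.single i 1 : Fin n → 𝕜) := by
    ext j
    simp [Finset.sum_apply, Pi.single_apply]
  conv_lhs => rw [h]
  refine (seminorm_sum_le q _ _).trans_eq (Finset.sum_congr rfl fun i _ => ?_)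
  rw [map_smul_eq_mul]

variable {ca cb : ℝ} {n m : ℕ} {P : SNPair 𝕜 n}

lemma MemB.fst_le (h : MemB ca cb P) (a : Fin n → 𝕜) : P.1 a ≤ ∑ i, ‖a i‖ := by
  refine (seminorm_le_sum_single P.1 a).trans_eq (Finset.sum_congr rfl fun i _ => ?_)
  rw [h.single_eq_one, mul_one]

lemma MemB.snd_single_le (h : MemB ca cb P) (i : Fin n) : P.2 (Pi.single i 1) ≤ ca := by
  simpa [h.single_eq_one] using h.snd_le (Pi.single i 1)

lemma MemB.fst_pos (h : MemB ca cb P) {w : Fin n → 𝕜} (hw : w ≠ 0) : 0 < P.1 w :=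
  lt_of_le_of_ne (apply_nonneg _ _) fun h0 => hw (h.eq_zero_of w h0.symm)

lemma MemB.fst_normalize (h : MemB ca cb P) {w : Fin n → 𝕜} (hw : w ≠ 0) :
    P.1 (normalize P.1 w) = 1 := by
  have := h.fst_pos hw
  rw [normalize, seminorm_ofReal_smul _ (by positivity), inv_mul_cancel₀ this.ne']

lemma Successive.exists_cuts {w : Fin m → Fin n → 𝕜} (hw : Successive w)
    (hne : ∀ j, w j ≠ 0) :
    ∃ k : Fin (m + 1) → ℕ, k 0 = 0 ∧ StrictMono k ∧ k (Fin.last m) ≤ n ∧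
      ∀ j i, w j i ≠ 0 → k j.castSucc ≤ i ∧ (i : ℕ) < k j.succ := by
  have htop : ∀ j, ∃ t : Fin n, w j t ≠ 0 ∧ ∀ i, w j i ≠ 0 → i ≤ t := by
    intro j
    obtain ⟨i₀, hi₀⟩ := Function.ne_iff.1 (hne j)
    have hS : (Finset.univ.filter fun i => w j i ≠ 0).Nonempty := ⟨i₀, by simpa using hi₀⟩
    refine ⟨Finset.max' _ hS, ?_, fun i hi => Finset.le_max' _ _ (by simpa using hi)⟩
    simpa using Finset.max'_mem _ hS
  choose t ht htm using htop
  cases m with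
  | zero =>
    exact ⟨fun _ => 0, rfl, fun i j h => absurd h (by omega), by simp,
      fun j => j.elim0⟩
  | succ m =>
    have hcut : ∀ j i, w j i ≠ 0 →
        (Fin.cases 0 (fun j => (t j : ℕ) + 1) j.castSucc : ℕ) ≤ i ∧ (i : ℕ) < t j + 1 := by
      intro j i hi
      refine ⟨?_, Nat.lt_succ_of_le (htm j i hi)⟩
      induction j using Fin.cases with
      | zero => exact Nat.zero_le _
      | succ j =>
        rw [← Fin.succ_castSucc, Fin.cases_succ]
        exact hw j.castSucc j.succ Fin.castSucc_lt_succ _ _ (ht _) hi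
    refine ⟨Fin.cases 0 fun j => (t j : ℕ) + 1, rfl, ?_, ?_, ?_⟩
    · rw [Fin.strictMono_iff_lt_succ]
      intro j
      exact (hcut j (t j) (ht j)).1.trans_lt (Nat.lt_succ_self _)
    · exact (t (Fin.last m)).2
    · exact hcut

lemma StableFam.exists_block {E : Fam 𝕜} (hE : StableFam ca cb E) (hP : P ∈ E n)
    {w : Fin m → Fin n → 𝕜} (hw : Successive w) (hone : ∀ j, P.1 (w j) = 1) :
    ∃ Q ∈ E m, (∀ b : Fin m → 𝕜, Q.1 b = P.1 (∑ j, b j • w j)) ∧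
      ∀ b : Fin m → 𝕜, Q.2 b = P.2 (∑ j, b j • w j) := by
  have hB := hE.1 n P hP
  have hne : ∀ j, w j ≠ 0 := fun j h0 => by simpa [h0] using hone j
  obtain ⟨k, hk0, hkm, hkl, hk⟩ := hw.exists_cuts hne
  have hzero : ∀ j j' (i : Fin n), k j.castSucc ≤ i → (i : ℕ) < k j.succ → j' ≠ j →
      w j' i = 0 := by
    intro j j' i h1 h2 hj
    by_contra h0
    obtain ⟨h3, h4⟩ := hk j' i h0
    rcases lt_or_gt_of_ne hj with h | h
    · have : k j'.succ ≤ k j.castSucc := hkm.monotone (by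
        rw [Fin.le_def]; simpa using h)
      omega
    · have : k j.succ ≤ k j'.castSucc := hkm.monotone (by
        rw [Fin.le_def]; simpa using h)
      omega
  have hpiece : ∀ j, piece (∑ j', w j') k j = w j := by
    intro j
    ext i
    simp only [piece, Finset.sum_apply]
    split_ifs with h
    · exact Finset.sum_eq_single_of_mem j (Finset.mem_univ _)
        fun j' _ hj' => hzero j j' i h.1 h.2 hj'
    · by_contra h0
      exact h (hk j i (Ne.symm h0))
  have htr : ∀ (l : ℕ), l ≤ m → ∀ b : Fin m → 𝕜, ∃ l' ≤ n,
      ∑ j, trunc l b j • w j = trunc l' (∑ j, b j • w j) := by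
    intro l hl b
    refine ⟨k ⟨l, Nat.lt_succ_of_le hl⟩, (hkm.monotone (Fin.le_last _)).trans hkl, ?_⟩
    ext i
    simp only [trunc, Finset.sum_apply, Pi.smul_apply, smul_eq_mul]
    split_ifs with hi
    · refine Finset.sum_congr rfl fun j _ => ?_
      split_ifs with hj
      · rfl
      · by_cases hji : w j i = 0
        · simp [hji]
        · have h1 := (hk j i hji).1
          have h2 : k ⟨l, Nat.lt_succ_of_le hl⟩ ≤ k j.castSucc := hkm.monotone (by
            rw [Fin.le_def]; simpa using hj)
          omega
    · refine Finset.sum_eq_zero fun j _ => ?_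
      split_ifs with hj
      · by_cases hji : w j i = 0
        · simp [hji]
        · have h1 := (hk j i hji).2
          have h2 : k j.succ ≤ k ⟨l, Nat.lt_succ_of_le hl⟩ := hkm.monotone (by
            rw [Fin.le_def]; simpa using hj)
          omega
      · simp
  let T := Fintype.linearCombination 𝕜 w
  have hT : ∀ b, T b = ∑ j, b j • w j := fun b => Fintype.linearCombination_apply 𝕜 w b
  have hsingle : ∀ j, T (Pi.single j 1) = w j := fun j => by
    simp [hT, Pi.single_apply, ite_smul]
  let Q : SNPair 𝕜 m := (P.1.comp T, P.2.comp T)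
  have hQ1 : ∀ b, Q.1 b = P.1 (∑ j, b j • w j) := fun b => by
    rw [← hT]; rfl
  have hQ2 : ∀ b, Q.2 b = P.2 (∑ j, b j • w j) := fun b => by
    rw [← hT]; rfl
  refine ⟨Q, hE.2.2 n m P hP Q ⟨?_, ?_, ?_, ?_, ?_⟩
    ⟨∑ j', w j', k, hk0, hkm, hkl, ?_, ?_, ?_⟩, hQ1, hQ2⟩
  · intro b hb
    have h0 := hB.eq_zero_of _ ((hQ1 b).symm.trans hb)
    ext j
    obtain ⟨i, hi⟩ := Function.ne_iff.1 (hne j)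
    have hji := hk j i hi
    have h1 := congrFun h0 i
    rw [Finset.sum_apply, Finset.sum_eq_single_of_mem j (Finset.mem_univ _)
      fun j' _ hj' => by simp [hzero j j' i hji.1 hji.2 hj']] at h1
    simpa [show w j i ≠ 0 from hi] using h1
  · intro j
    rw [show Q.1 (Pi.single j 1) = P.1 (T (Pi.single j 1)) from rfl, hsingle, hone]
  · intro l hl b
    obtain ⟨l', hl', h⟩ := htr l hl b
    rw [hQ1, hQ1, h]
    exact hB.trunc_fst l' hl' _
  · intro l hl b
    obtain ⟨l', hl', h⟩ := htr l hl b
    rw [hQ2, hQ2, h]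
    exact hB.trunc_snd l' hl' _
  · intro b
    exact hB.snd_le _
  · simpa only [hpiece] using hone
  · simpa only [hpiece] using hQ1
  · simpa only [hpiece] using hQ2

end Blocks

section LowerEstimates

variable {𝕜 : Type*} [RCLike 𝕜]

/-- The lower `ℓ₁`-estimate with constant `K` for a single seminorm. -/
def L1Lower (K : ℝ) {n : ℕ} (q : Seminorm 𝕜 (Fin n → 𝕜)) : Prop :=
  ∀ a : Fin n → 𝕜, K * ∑ i, ‖a i‖ ≤ q a

variable {ca cb : ℝ} {n m : ℕ} {P : SNPair 𝕜 n}

lemma Successive.sum_norm {w : Fin m → Fin n → 𝕜} (hw : Successive w) (b : Fin m → 𝕜) :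
    ∑ i, ‖(∑ j, b j • w j) i‖ = ∑ j, ‖b j‖ * ∑ i, ‖w j i‖ := by
  simp_rw [Finset.mul_sum]
  rw [Finset.sum_comm]
  refine Finset.sum_congr rfl fun i _ => ?_
  rw [Finset.sum_apply]
  by_cases h : ∃ j, w j i ≠ 0
  · obtain ⟨j, hj⟩ := h
    have hz : ∀ j', j' ≠ j → w j' i = 0 := by
      intro j' hj'
      by_contra h0
      rcases lt_or_gt_of_ne hj' with h | h
      · exact lt_irrefl _ (hw _ _ h i i h0 hj)
      · exact lt_irrefl _ (hw _ _ h i i hj h0)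
    rw [Finset.sum_eq_single_of_mem j (Finset.mem_univ _) fun j' _ hj' => by simp [hz j' hj'],
      Finset.sum_eq_single_of_mem j (Finset.mem_univ _) fun j' _ hj' => by simp [hz j' hj']]
    simp
  · push Not at h
    simp [h]

/-- The vector with coordinate `b s` at the place `f s`. -/
def place (f : Fin m → Fin n) (b : Fin m → 𝕜) : Fin n → 𝕜 :=
  ∑ s, b s • (Pi.single (f s) 1 : Fin n → 𝕜)

lemma successive_single {f : Fin m → Fin n} (hf : StrictMono f) :
    Successive fun s => (Pi.single (f s) 1 : Fin n → 𝕜) := by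
  intro j j' hj i i' hi hi'
  have h1 : i = f j := by
    by_contra h; simp [h] at hi
  have h2 : i' = f j' := by
    by_contra h; simp [h] at hi'
  rw [h1, h2]
  exact hf hj

lemma place_ne_zero {f : Fin m → Fin n} {b : Fin m → 𝕜} {i : Fin n} (h : place f b i ≠ 0) :
    ∃ s, i = f s := by
  by_contra! hs
  exact h (by simp [place, Finset.sum_apply, hs])

lemma sum_norm_place {f : Fin m → Fin n} (hf : StrictMono f) (b : Fin m → 𝕜) :
    ∑ i, ‖place f b i‖ = ∑ s, ‖b s‖ := by
  rw [place, (successive_single hf).sum_norm]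
  refine Finset.sum_congr rfl fun s _ => ?_
  rw [Finset.sum_eq_single_of_mem (f s) (Finset.mem_univ _) fun i _ hi => by simp [hi]]
  simp

lemma StableFam.exists_place {E : Fam 𝕜} (hE : StableFam ca cb E) (hP : P ∈ E n)
    {f : Fin m → Fin n} (hf : StrictMono f) :
    ∃ Q ∈ E m, (∀ b, Q.1 b = P.1 (place f b)) ∧ ∀ b, Q.2 b = P.2 (place f b) :=
  hE.exists_block hP (successive_single hf) fun _ => (hE.1 n P hP).single_eq_one _

lemma place_single (f : Fin m → Fin n) (s : Fin m) :
    place f (Pi.single s (1 : 𝕜)) = Pi.single (f s) 1 := by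
  simp [place, Pi.single_apply, ite_smul]

/-- The enumeration of the `l`-th of `M` consecutive groups of `M` coordinates. -/
def groupIndex {M : ℕ} (l s : Fin M) : Fin (M * M) := finProdFinEquiv (l, s)

lemma groupIndex_val {M : ℕ} (l s : Fin M) : (groupIndex l s : ℕ) = s + M * l := rfl

lemma strictMono_groupIndex {M : ℕ} (l : Fin M) : StrictMono (groupIndex l) := by
  intro s s' h
  rw [Fin.lt_def, groupIndex_val, groupIndex_val]
  exact Nat.add_lt_add_right h _

lemma successive_place_groupIndex {M : ℕ} (b : Fin M → Fin M → 𝕜) :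
    Successive fun l => place (groupIndex l) (b l) := by
  intro l l' hl i i' hi hi'
  obtain ⟨s, rfl⟩ := place_ne_zero hi
  obtain ⟨s', rfl⟩ := place_ne_zero hi'
  rw [Fin.lt_def, groupIndex_val, groupIndex_val]
  have h1 : M * (l + 1) ≤ M * l' := Nat.mul_le_mul_left _ hl
  have := s.2
  rw [mul_add] at h1
  omega

lemma StableFam.exists_normalize {E : Fam 𝕜} (hE : StableFam ca cb E) (hP : P ∈ E n)
    {w : Fin m → Fin n → 𝕜} (hw : Successive w) (hne : ∀ j, w j ≠ 0) :
    ∃ Q ∈ E m, (∀ b : Fin m → 𝕜, Q.1 b = P.1 (∑ j, b j • normalize P.1 (w j))) ∧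
      ∀ b : Fin m → 𝕜, Q.2 b = P.2 (∑ j, b j • normalize P.1 (w j)) := by
  refine hE.exists_block hP ?_ fun j => (hE.1 n P hP).fst_normalize (hne j)
  intro j j' hj i i' hi hi'
  exact hw j j' hj i i' (right_ne_zero_of_mul hi) (right_ne_zero_of_mul hi')

lemma Successive.normalize {w : Fin m → Fin n → 𝕜} (hw : Successive w)
    (r : Seminorm 𝕜 (Fin n → 𝕜)) :
    Successive fun j => AsymSeminorms.normalize r (w j) := fun j j' hj i i' hi hi' =>
  hw j j' hj i i' (right_ne_zero_of_mul hi) (right_ne_zero_of_mul hi')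

lemma L1Lower.sum_normalize {q r : Seminorm 𝕜 (Fin n → 𝕜)} {K t : ℝ} (hK : 0 ≤ K)
    (hq : L1Lower K q) {w : Fin m → Fin n → 𝕜} (hw : Successive w) (hr : ∀ j, 0 < r (w j))
    (ht : ∀ j, t * r (w j) ≤ ∑ i, ‖w j i‖) (b : Fin m → 𝕜) :
    K * t * ∑ j, ‖b j‖ ≤ q (∑ j, b j • normalize r (w j)) := by
  refine le_trans ?_ (hq _)
  rw [(hw.normalize r).sum_norm, mul_assoc, Finset.mul_sum]
  refine mul_le_mul_of_nonneg_left (Finset.sum_le_sum fun j _ => ?_) hK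
  rw [mul_comm]
  refine mul_le_mul_of_nonneg_left ?_ (norm_nonneg _)
  have : ∑ i, ‖AsymSeminorms.normalize r (w j) i‖ = (r (w j))⁻¹ * ∑ i, ‖w j i‖ := by
    simp [AsymSeminorms.normalize, Finset.mul_sum, abs_of_pos (hr j)]
  rw [this, inv_mul_eq_div, le_div_iff₀ (hr j)]
  exact ht j

/-- Some member of `E` of length `n` has constants `δ` and `L` in the lower `ℓ₁`-estimates for
its norm and its seminorm, and `ρ (e_i) ≤ U`. -/
def HasL1Bounds (E : Fam 𝕜) (δ L U : ℝ) (n : ℕ) : Prop :=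
  ∃ P ∈ E n, L1Lower δ P.1 ∧ L1Lower L P.2 ∧ ∀ i, P.2 (Pi.single i 1) ≤ U

variable {E : Fam 𝕜} {δ L U : ℝ}

lemma StableFam.hasL1Bounds_of_place (hE : StableFam ca cb E) (hP : P ∈ E n)
    {f : Fin m → Fin n} (hf : StrictMono f)
    (h1 : ∀ b, δ * ∑ i, ‖b i‖ ≤ P.1 (place f b)) (h2 : ∀ b, L * ∑ i, ‖b i‖ ≤ P.2 (place f b))
    (h3 : ∀ i, P.2 (Pi.single i 1) ≤ U) : HasL1Bounds E δ L U m := by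
  obtain ⟨Q, hQ, hQ1, hQ2⟩ := hE.exists_place hP hf
  refine ⟨Q, hQ, fun b => hQ1 b ▸ h1 b, fun b => hQ2 b ▸ h2 b, fun i => ?_⟩
  rw [hQ2, place_single]
  exact h3 _

lemma L1Lower.place {K : ℝ} {q : Seminorm 𝕜 (Fin n → 𝕜)} (hq : L1Lower K q)
    {f : Fin m → Fin n} (hf : StrictMono f) (b : Fin m → 𝕜) :
    K * ∑ i, ‖b i‖ ≤ q (place f b) := by
  rw [← sum_norm_place hf]
  exact hq _

lemma HasL1Bounds.of_le (hE : StableFam ca cb E) (h : HasL1Bounds E δ L U n) (hmn : m ≤ n) :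
    HasL1Bounds E δ L U m := by
  obtain ⟨P, hP, h1, h2, h3⟩ := h
  have hf := Fin.strictMono_castLE hmn
  exact hE.hasL1Bounds_of_place hP hf (h1.place hf) (h2.place hf) h3

lemma HasL1Bounds.fst_or (hE : StableFam ca cb E) (hδ : 0 < δ) (hL : 0 ≤ L) {M : ℕ}
    (h : HasL1Bounds E δ L ca (M * M)) : HasL1Bounds E (√δ) L ca M := by
  obtain ⟨P, hP, h1, h2, h3⟩ := h
  have hB := hE.1 _ P hP
  by_cases hl : ∃ l : Fin M, ∀ b, √δ * ∑ i, ‖b i‖ ≤ P.1 (place (groupIndex l) b)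
  · obtain ⟨l, hl⟩ := hl
    exact hE.hasL1Bounds_of_place hP (strictMono_groupIndex l) hl
      (h2.place (strictMono_groupIndex l)) h3
  push Not at hl
  choose b hb using hl
  set w := fun l => place (groupIndex l) (b l) with hwdef
  have hw : Successive w := successive_place_groupIndex b
  have hsum : ∀ l, ∑ i, ‖w l i‖ = ∑ s, ‖b l s‖ := fun l =>
    sum_norm_place (strictMono_groupIndex l) (b l)
  have hne : ∀ l, w l ≠ 0 := by
    intro l h0
    have h := hb l
    rw [← hsum, h0] at h
    exact (apply_nonneg P.1 (place (groupIndex l) (b l))).not_gt (by simpa using h)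
  have hpos : ∀ l, 0 < P.1 (w l) := fun l => hB.fst_pos (hne l)
  obtain ⟨Q, hQ, hQ1, hQ2⟩ := hE.exists_normalize hP hw hne
  have hs : 0 < √δ := Real.sqrt_pos.2 hδ
  refine ⟨Q, hQ, fun c => ?_, fun c => ?_, (hE.1 _ Q hQ).snd_single_le⟩
  · rw [hQ1]
    have hδs : √δ = δ * (√δ)⁻¹ := by
      field_simp
      exact Real.sq_sqrt hδ.le
    rw [hδs]
    refine h1.sum_normalize hδ.le hw hpos (fun l => ?_) c
    rw [inv_mul_le_iff₀ hs, hsum]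
    exact (hb l).le
  · rw [hQ2, ← mul_one L]
    refine h2.sum_normalize hL hw hpos (fun l => ?_) c
    rw [one_mul]
    exact hB.fst_le _

lemma HasL1Bounds.snd_or (hE : StableFam ca cb E) (hδ : 0 < δ) (hL : 0 ≤ L) {t : ℝ}
    (ht : 0 ≤ t) {M : ℕ} (h : HasL1Bounds E δ L ca (M * M)) :
    HasL1Bounds E δ t ca M ∨ HasL1Bounds E δ L (t / δ) M := by
  obtain ⟨P, hP, h1, h2, h3⟩ := h
  have hB := hE.1 _ P hP
  by_cases hl : ∃ l : Fin M, ∀ b, t * ∑ i, ‖b i‖ ≤ P.2 (place (groupIndex l) b)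
  · obtain ⟨l, hl⟩ := hl
    exact Or.inl (hE.hasL1Bounds_of_place hP (strictMono_groupIndex l)
      (h1.place (strictMono_groupIndex l)) hl h3)
  push Not at hl
  choose b hb using hl
  set w := fun l => place (groupIndex l) (b l) with hwdef
  have hw : Successive w := successive_place_groupIndex b
  have hsum : ∀ l, ∑ i, ‖w l i‖ = ∑ s, ‖b l s‖ := fun l =>
    sum_norm_place (strictMono_groupIndex l) (b l)
  have hne : ∀ l, w l ≠ 0 := by
    intro l h0
    have h := hb l
    rw [← hsum, h0] at h
    exact (apply_nonneg P.2 (place (groupIndex l) (b l))).not_gt (by simpa using h)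
  have hpos : ∀ l, 0 < P.1 (w l) := fun l => hB.fst_pos (hne l)
  obtain ⟨Q, hQ, hQ1, hQ2⟩ := hE.exists_normalize hP hw hne
  have hle : ∀ l, 1 * P.1 (w l) ≤ ∑ i, ‖w l i‖ := fun l => by
    rw [one_mul]
    exact hB.fst_le _
  refine Or.inr ⟨Q, hQ, fun c => ?_, fun c => ?_, fun l => ?_⟩
  · rw [hQ1, ← mul_one δ]
    exact h1.sum_normalize hδ.le hw hpos hle c
  · rw [hQ2, ← mul_one L]
    exact h2.sum_normalize hL hw hpos hle c
  · have : ∑ j, (Pi.single l 1 : Fin M → 𝕜) j • AsymSeminorms.normalize P.1 (w j) =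
        AsymSeminorms.normalize P.1 (w l) := by
      simp [Pi.single_apply, ite_smul]
    rw [hQ2, this, AsymSeminorms.normalize, seminorm_ofReal_smul _ (inv_nonneg.2 (hpos l).le),
      inv_mul_le_iff₀ (hpos l), mul_div_assoc', le_div_iff₀ hδ]
    have h4 := h1 (w l)
    rw [hsum] at h4
    have h5 : P.2 (w l) ≤ t * ∑ i, ‖b l i‖ := (hb l).le
    calc P.2 (w l) * δ ≤ t * (∑ i, ‖b l i‖) * δ := by gcongr
      _ = t * (δ * ∑ i, ‖b l i‖) := by ring
      _ ≤ t * P.1 (w l) := by gcongr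
      _ = _ := by ring

end LowerEstimates

section Representability

variable {𝕜 : Type*} [RCLike 𝕜] {ca cb : ℝ} {E : Fam 𝕜} {δ L U ϱ : ℝ} {n : ℕ}

lemma L1Lower.mono {K K' : ℝ} {q : Seminorm 𝕜 (Fin n → 𝕜)} (hq : L1Lower K q) (h : K' ≤ K) :
    L1Lower K' q := fun a =>
  (mul_le_mul_of_nonneg_right h (Finset.sum_nonneg fun _ _ => norm_nonneg _)).trans (hq a)

lemma HasL1Bounds.mono {δ' L' U' : ℝ} (h : HasL1Bounds E δ L U n) (hδ : δ' ≤ δ) (hL : L' ≤ L)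
    (hU : U ≤ U') : HasL1Bounds E δ' L' U' n := by
  obtain ⟨P, hP, h1, h2, h3⟩ := h
  exact ⟨P, hP, h1.mono hδ, h2.mono hL, fun i => (h3 i).trans hU⟩

lemma HasL1Bounds.lower_le (hn : 0 < n) (h : HasL1Bounds E δ L U n) : L ≤ U := by
  obtain ⟨P, hP, h1, h2, h3⟩ := h
  refine le_trans ?_ (h3 ⟨0, hn⟩)
  refine le_trans (le_of_eq ?_) (h2 (Pi.single ⟨0, hn⟩ 1))
  rw [Finset.sum_eq_single_of_mem ⟨0, hn⟩ (Finset.mem_univ _) fun i _ hi => by simp [hi]]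
  simp

lemma StableFam.hasL1Bounds_of_frequently (hE : StableFam ca cb E) (hca : 0 < ca)
    (h : ∀ N : ℕ, ∃ n, N ≤ n ∧ ∃ P ∈ E n, L1Lower ϱ P.2) (n : ℕ) :
    HasL1Bounds E (ϱ / ca) ϱ ca n := by
  obtain ⟨m, hm, P, hP, hϱ⟩ := h n
  refine HasL1Bounds.of_le hE ⟨P, hP, fun a => ?_, hϱ, (hE.1 _ P hP).snd_single_le⟩ hm
  rw [div_mul_eq_mul_div, div_le_iff₀ hca, mul_comm (P.1 a)]
  exact (hϱ a).trans ((hE.1 _ P hP).snd_le a)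

/-- James' distortion argument for the norms of the members of `E`. -/
lemma StableFam.hasL1Bounds_of_lt_one (hE : StableFam ca cb E) (hδ0 : 0 < δ) (hδ1 : δ ≤ 1)
    (hL : 0 ≤ L) (h : ∀ n, HasL1Bounds E δ L ca n) {δ' : ℝ} (hδ' : δ' < 1) (n : ℕ) :
    HasL1Bounds E δ' L ca n := by
  set S := {d : ℝ | 0 < d ∧ d ≤ 1 ∧ ∀ n, HasL1Bounds E d L ca n}
  have hδS : δ ∈ S := ⟨hδ0, hδ1, h⟩
  have hbdd : BddAbove S := ⟨1, fun d hd => hd.2.1⟩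
  have hd0 : 0 < sSup S := hδ0.trans_le (le_csSup hbdd hδS)
  have hd1 : 1 ≤ sSup S := by
    by_contra! hlt
    obtain ⟨d, hdS, hd⟩ := exists_lt_of_lt_csSup ⟨δ, hδS⟩
      (show sSup S ^ 2 < sSup S by nlinarith)
    have hmem : √d ∈ S := ⟨Real.sqrt_pos.2 hdS.1, Real.sqrt_le_one.2 hdS.2.1,
      fun m => HasL1Bounds.fst_or hE hdS.1 hL (hdS.2.2 (m * m))⟩
    exact (le_csSup hbdd hmem).not_gt (Real.lt_sqrt_of_sq_lt hd)
  obtain ⟨d, hdS, hd⟩ := exists_lt_of_lt_csSup ⟨δ, hδS⟩ (hδ'.trans_le hd1)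
  exact (hdS.2.2 n).mono hd.le le_rfl le_rfl

lemma StableFam.exists_almost_isometric (hE : StableFam ca cb E) (hϱ : 0 < ϱ)
    (h : ∀ N : ℕ, ∃ n, N ≤ n ∧ ∃ P ∈ E n, L1Lower ϱ P.2) :
    ∃ c, 0 < c ∧ c ≤ ca ∧ ∀ ε, 0 < ε → ∀ n, HasL1Bounds E (1 - ε) (c - ε) (c + ε) n := by
  have hϱca : ϱ ≤ ca := by
    obtain ⟨n, hn, P, hP, hP2⟩ := h 1
    refine HasL1Bounds.lower_le (E := E) (δ := 0) hn
      ⟨P, hP, fun a => by simp, hP2, (hE.1 _ P hP).snd_single_le⟩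
  have hca : 0 < ca := hϱ.trans_le hϱca
  set G := {L : ℝ | 0 < L ∧ ∀ δ < 1, ∀ n, HasL1Bounds E δ L ca n}
  have hϱG : ϱ ∈ G := ⟨hϱ, fun δ hδ n => hE.hasL1Bounds_of_lt_one (div_pos hϱ hca)
    ((div_le_one hca).2 hϱca) hϱ.le (hE.hasL1Bounds_of_frequently hca h) hδ n⟩
  have hub : ∀ L ∈ G, L ≤ ca := fun L hL =>
    HasL1Bounds.lower_le one_pos (hL.2 0 one_pos 1)
  have hbdd : BddAbove G := ⟨ca, hub⟩
  have hc0 : 0 < sSup G := hϱ.trans_le (le_csSup hbdd hϱG)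
  refine ⟨sSup G, hc0, csSup_le ⟨ϱ, hϱG⟩ hub, fun ε hε n => ?_⟩
  set c := sSup G
  obtain ⟨L, hLG, hL⟩ := exists_lt_of_lt_csSup ⟨ϱ, hϱG⟩ (show c - ε < sSup G by
    change c - ε < c
    linarith)
  have hnot : c + ε / 2 ∉ G := fun hmem => by
    have : c + ε / 2 ≤ c := le_csSup hbdd hmem
    linarith
  have hnot' : ∃ δ₀ < 1, ∃ n₀, ¬ HasL1Bounds E δ₀ (c + ε / 2) ca n₀ := by
    by_contra! hcon
    exact hnot ⟨by linarith, hcon⟩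
  obtain ⟨δ₀, hδ₀, n₀, hn₀⟩ := hnot'
  set κ := (c + ε / 2) / (c + ε)
  have hκ0 : 0 < κ := by positivity
  have hκ1 : κ < 1 := (div_lt_one (by linarith)).2 (by linarith)
  set d := max (max δ₀ (1 - ε)) κ
  have hd1 : d < 1 := max_lt (max_lt hδ₀ (by linarith)) hκ1
  have hd0 : 0 < d := hκ0.trans_le (le_max_right _ _)
  have hdκ : κ ≤ d := le_max_right _ _
  have hdδ : δ₀ ≤ d := (le_max_left _ _).trans (le_max_left _ _)
  have hdε : 1 - ε ≤ d := (le_max_right _ _).trans (le_max_left _ _)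
  rcases HasL1Bounds.snd_or hE hd0 hLG.1.le (t := c + ε / 2) (by linarith)
    (hLG.2 d hd1 (max n n₀ * max n n₀)) with h1 | h1
  · exact absurd ((h1.of_le hE (le_max_right _ _)).mono hdδ le_rfl le_rfl) hn₀
  · refine (h1.of_le hE (le_max_left _ _)).mono hdε hL.le ?_
    rw [div_le_iff₀ hd0]
    calc c + ε / 2 = (c + ε) * κ := by
          simp only [κ]
          field_simp
      _ ≤ (c + ε) * d := by gcongr

/-- The multiple `t ‖·‖₁` of the `ℓ₁`-norm. -/
def l1Seminorm (𝕜 : Type*) [RCLike 𝕜] (n : ℕ) {t : ℝ} (ht : 0 ≤ t) :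
    Seminorm 𝕜 (Fin n → 𝕜) :=
  Seminorm.of (fun a => t * ∑ i, ‖a i‖)
    (fun a b => by
      rw [← mul_add, ← Finset.sum_add_distrib]
      exact mul_le_mul_of_nonneg_left (Finset.sum_le_sum fun i _ => norm_add_le _ _) ht)
    fun c a => by
      simp only [Pi.smul_apply, smul_eq_mul, norm_mul, ← Finset.mul_sum]
      ring

lemma l1Seminorm_apply {t : ℝ} (ht : 0 ≤ t) (a : Fin n → 𝕜) :
    l1Seminorm 𝕜 n ht a = t * ∑ i, ‖a i‖ := rfl

lemma memB_l1Seminorm (hcb : 1 ≤ cb) {c : ℝ} (hc : 0 ≤ c) (hcca : c ≤ ca) :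
    MemB ca cb ((l1Seminorm 𝕜 n zero_le_one, l1Seminorm 𝕜 n hc) : SNPair 𝕜 n) := by
  have htr : ∀ {t : ℝ} (ht : 0 ≤ t) (m : ℕ) (a : Fin n → 𝕜),
      l1Seminorm 𝕜 n ht (trunc m a) ≤ cb * l1Seminorm 𝕜 n ht a := by
    intro t ht m a
    refine le_trans ?_ (le_mul_of_one_le_left (apply_nonneg _ _) hcb)
    refine mul_le_mul_of_nonneg_left (Finset.sum_le_sum fun i _ => ?_) ht
    simp only [trunc]
    split_ifs <;> simp
  refine ⟨fun x hx => ?_, fun i => ?_, fun m _ => htr zero_le_one m, fun m _ => htr hc m,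
    fun x => ?_⟩
  · rw [l1Seminorm_apply, one_mul,
      Finset.sum_eq_zero_iff_of_nonneg fun _ _ => norm_nonneg _] at hx
    ext i
    exact norm_eq_zero.1 (hx i (Finset.mem_univ i))
  · rw [l1Seminorm_apply, one_mul,
      Finset.sum_eq_single_of_mem i (Finset.mem_univ _) fun j _ hj => by simp [hj]]
    simp
  · rw [l1Seminorm_apply, l1Seminorm_apply, one_mul]
    exact mul_le_mul_of_nonneg_right hcca (Finset.sum_nonneg fun _ _ => norm_nonneg _)

lemma StableFam.l1_mem (hE : StableFam ca cb E) (hcb : 1 ≤ cb) {c : ℝ} (hc : 0 ≤ c)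
    (hcca : c ≤ ca) (h : ∀ ε, 0 < ε → HasL1Bounds E (1 - ε) (c - ε) (c + ε) n) :
    ((l1Seminorm 𝕜 n zero_le_one, l1Seminorm 𝕜 n hc) : SNPair 𝕜 n) ∈ E n := by
  refine hE.2.1 n _ (memB_l1Seminorm hcb hc hcca) fun ε hε => ?_
  set η := ε / (n + 1)
  have hη : 0 < η := by positivity
  obtain ⟨Q, hQ, h1, h2, h3⟩ := h η hη
  have hB := hE.1 n Q hQ
  refine ⟨Q, hQ, lt_of_le_of_lt (Real.sSup_le ?_ (show 0 ≤ η * n by positivity)) ?_⟩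
  · rintro _ ⟨a, ha, rfl⟩
    have hs : ∑ i, ‖a i‖ ≤ n := by
      simpa using Finset.sum_le_sum fun i (_ : i ∈ Finset.univ) => ha i
    have hηs := mul_le_mul_of_nonneg_left hs hη.le
    have e1 := h1 a
    have e2 := h2 a
    have e3 := hB.fst_le a
    have e4 : Q.2 a ≤ (c + η) * ∑ i, ‖a i‖ := by
      refine (seminorm_le_sum_single Q.2 a).trans ?_
      rw [mul_comm, Finset.sum_mul]
      exact Finset.sum_le_sum fun i _ => mul_le_mul_of_nonneg_left (h3 i) (norm_nonneg _)
    have hs0 : 0 ≤ η * ∑ i, ‖a i‖ :=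
      mul_nonneg hη.le (Finset.sum_nonneg fun _ _ => norm_nonneg _)
    simp only [l1Seminorm_apply, one_mul]
    refine max_le (abs_le.2 ⟨?_, ?_⟩) (abs_le.2 ⟨?_, ?_⟩) <;> linarith
  · simp only [η]
    rw [div_mul_eq_mul_div, div_lt_iff₀ (by positivity)]
    nlinarith

end Representability

section RealToScalar

variable {𝕜 : Type*} [RCLike 𝕜] {ca cb : ℝ} {E : Fam 𝕜} {δ : ℝ} {n : ℕ}

/-- The vector in `𝕜^n` with the given real coordinates. -/
def ofRealVec (u : Fin n → ℝ) : Fin n → 𝕜 := fun i => (u i : 𝕜)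

/-- The lower `ℓ₁`-estimate with constant `K` for real coefficients. -/
def RealL1Lower (K : ℝ) (q : Seminorm 𝕜 (Fin n → 𝕜)) : Prop :=
  ∀ u : Fin n → ℝ, K * ∑ i, |u i| ≤ q (ofRealVec u)

lemma norm_rclike_I_le_one : ‖(RCLike.I : 𝕜)‖ ≤ 1 := by
  rw [RCLike.norm_I]
  split_ifs <;> norm_num

lemma norm_le_abs_re_add_abs_im (z : 𝕜) : ‖z‖ ≤ |RCLike.re z| + |RCLike.im z| := by
  conv_lhs => rw [← RCLike.re_add_im z]
  refine (norm_add_le _ _).trans ?_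
  rw [norm_mul, RCLike.norm_ofReal, RCLike.norm_ofReal]
  exact add_le_add_right (mul_le_of_le_one_right (abs_nonneg _) norm_rclike_I_le_one) _

lemma seminorm_imVec_ge {q : Seminorm 𝕜 (Fin n → 𝕜)} {η : ℝ} (hδ : 0 ≤ δ)
    (hq : RealL1Lower δ q) {w : Fin n → 𝕜} (hw : q w ≤ η * ∑ i, ‖w i‖) :
    (δ - η) / 2 * ∑ i, ‖w i‖ ≤ q (ofRealVec fun i => RCLike.im (w i)) := by
  set u : Fin n → 𝕜 := ofRealVec fun i => RCLike.re (w i)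
  set v : Fin n → 𝕜 := ofRealVec fun i => RCLike.im (w i)
  have hdec : u = w - (RCLike.I : 𝕜) • v := by
    ext i
    have := RCLike.re_add_im (w i)
    simp only [u, v, ofRealVec, Pi.sub_apply, Pi.smul_apply, smul_eq_mul]
    linear_combination this
  have h1 : q u ≤ q w + q v := by
    rw [hdec]
    refine (map_sub_le_add q _ _).trans ?_
    rw [map_smul_eq_mul]
    have := mul_le_mul_of_nonneg_right (norm_rclike_I_le_one (𝕜 := 𝕜)) (apply_nonneg q v)
    linarith
  have h2 := hq fun i => RCLike.re (w i)
  have h3 := hq fun i => RCLike.im (w i)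
  have h4 : ∑ i, ‖w i‖ ≤ ∑ i, |RCLike.re (w i)| + ∑ i, |RCLike.im (w i)| := by
    rw [← Finset.sum_add_distrib]
    exact Finset.sum_le_sum fun i _ => norm_le_abs_re_add_abs_im _
  have h5 := mul_le_mul_of_nonneg_left h4 hδ
  change _ ≤ q u at h2
  change _ ≤ q v at h3
  linarith

lemma RealL1Lower.sum_imVec {P : SNPair 𝕜 n} (hB : MemB ca cb P) {m : ℕ} {η : ℝ} (hδ : 0 < δ)
    (hca : 0 < ca) (hηδ : 6 * η ≤ δ) (hηca : 8 * ca * η ≤ δ ^ 2)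
    (hq : RealL1Lower δ P.2) {w : Fin m → Fin n → 𝕜} (hw : Successive w)
    (hsmall : ∀ l, P.2 (w l) ≤ η * ∑ i, ‖w l i‖) (c : Fin m → 𝕜) :
    η * ∑ l, ‖c l‖ * ∑ i, ‖w l i‖ ≤
      P.2 (∑ l, c l • ofRealVec fun i => RCLike.im (w l i)) := by
  set v : Fin m → Fin n → 𝕜 := fun l => ofRealVec fun i => RCLike.im (w l i)
  set x : Fin m → Fin n → ℝ := fun l i =>
    RCLike.re (c l) * RCLike.im (w l i) - RCLike.im (c l) * RCLike.re (w l i)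
  have hx : ∀ l, ofRealVec (x l) = c l • v l - ((RCLike.im (c l) : ℝ) : 𝕜) • w l := by
    intro l
    ext i
    have h1 := RCLike.re_add_im (w l i)
    have h2 := RCLike.re_add_im (c l)
    simp only [x, v, ofRealVec, Pi.sub_apply, Pi.smul_apply, smul_eq_mul]
    push_cast
    linear_combination ((RCLike.im (w l i) : ℝ) : 𝕜) * h2 - ((RCLike.im (c l) : ℝ) : 𝕜) * h1
  have hxs : Successive fun l => (ofRealVec (x l) : Fin n → 𝕜) := by
    have : ∀ l i, (ofRealVec (x l) : Fin n → 𝕜) i ≠ 0 → w l i ≠ 0 := by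
      intro l i h h0
      exact h (by simp [ofRealVec, x, h0])
    exact fun j j' hj i i' hi hi' => hw j j' hj i i' (this j i hi) (this j' i' hi')
  have hsum : ∑ i, |∑ l, x l i| = ∑ l, ∑ i, ‖(ofRealVec (x l) : Fin n → 𝕜) i‖ := by
    have := hxs.sum_norm fun _ => (1 : 𝕜)
    simp only [one_smul, norm_one, one_mul, Finset.sum_apply] at this
    rw [← this]
    refine Finset.sum_congr rfl fun i _ => ?_
    simp only [ofRealVec]
    rw [← RCLike.ofReal_sum, RCLike.norm_ofReal]
  have him : ∀ l, |RCLike.im (c l)| ≤ ‖c l‖ := fun l => RCLike.abs_im_le_norm _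
  have hterm : ∀ l, |RCLike.im (c l)| * P.2 (w l) ≤ ‖c l‖ * (η * ∑ i, ‖w l i‖) := fun l =>
    mul_le_mul (him l) (hsmall l) (apply_nonneg _ _) (norm_nonneg _)
  have hlow : ∀ l, 2 * η * (‖c l‖ * ∑ i, ‖w l i‖) ≤
      δ * ∑ i, ‖(ofRealVec (x l) : Fin n → 𝕜) i‖ := by
    intro l
    have h1 : P.2 (c l • v l) ≤ P.2 (ofRealVec (x l)) + |RCLike.im (c l)| * P.2 (w l) := by
      have : c l • v l = ofRealVec (x l) + ((RCLike.im (c l) : ℝ) : 𝕜) • w l := by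
        rw [hx]
        abel
      rw [this]
      refine (map_add_le_add P.2 _ _).trans_eq ?_
      rw [map_smul_eq_mul, RCLike.norm_ofReal]
    rw [map_smul_eq_mul] at h1
    have h2 := mul_le_mul_of_nonneg_left (seminorm_imVec_ge hδ.le hq (hsmall l))
      (norm_nonneg (c l))
    have h3 : P.2 (ofRealVec (x l)) ≤ ca * ∑ i, ‖(ofRealVec (x l) : Fin n → 𝕜) i‖ :=
      (hB.snd_le _).trans (mul_le_mul_of_nonneg_left (hB.fst_le _) hca.le)
    have h4 := hterm l
    set B := ‖c l‖ * ∑ i, ‖w l i‖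
    have hB0 : 0 ≤ B := mul_nonneg (norm_nonneg _) (Finset.sum_nonneg fun _ _ => norm_nonneg _)
    have h5 : (δ - 3 * η) / 2 * B ≤ ca * ∑ i, ‖(ofRealVec (x l) : Fin n → 𝕜) i‖ := by
      change _ ≤ ‖c l‖ * P.2 (v l) at h2
      have e1 : ‖c l‖ * ((δ - η) / 2 * ∑ i, ‖w l i‖) = (δ - η) / 2 * B := by
        simp only [B]; ring
      have e2 : ‖c l‖ * (η * ∑ i, ‖w l i‖) = η * B := by
        simp only [B]; ring
      linarith
    refine le_of_mul_le_mul_left ?_ hca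
    have h6 := mul_le_mul_of_nonneg_left h5 hδ.le
    have h7 : ca * (2 * η) ≤ δ * ((δ - 3 * η) / 2) := by nlinarith
    have h8 := mul_le_mul_of_nonneg_right h7 hB0
    linarith
  have hdec : ∑ l, c l • v l =
      ofRealVec (fun i => ∑ l, x l i) + ∑ l, ((RCLike.im (c l) : ℝ) : 𝕜) • w l := by
    have : (ofRealVec (fun i => ∑ l, x l i) : Fin n → 𝕜) = ∑ l, ofRealVec (x l) := by
      ext i
      simp [ofRealVec]
    rw [this, ← Finset.sum_add_distrib]
    refine Finset.sum_congr rfl fun l _ => ?_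
    rw [hx]
    abel
  have h1 : P.2 (ofRealVec fun i => ∑ l, x l i) ≤
      P.2 (∑ l, c l • v l) + ∑ l, ‖c l‖ * (η * ∑ i, ‖w l i‖) := by
    have : (ofRealVec (fun i => ∑ l, x l i) : Fin n → 𝕜) =
        ∑ l, c l • v l - ∑ l, ((RCLike.im (c l) : ℝ) : 𝕜) • w l := by
      rw [hdec]
      abel
    rw [this]
    refine (map_sub_le_add P.2 _ _).trans (add_le_add_right ?_ _)
    refine (seminorm_sum_le P.2 _ _).trans (Finset.sum_le_sum fun l _ => ?_)
    rw [map_smul_eq_mul, RCLike.norm_ofReal]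
    exact hterm l
  have h2 := hq fun i => ∑ l, x l i
  rw [hsum, Finset.mul_sum] at h2
  have h3 := Finset.sum_le_sum fun l (_ : l ∈ Finset.univ) => hlow l
  rw [← Finset.mul_sum] at h3
  have h4 : ∑ l, ‖c l‖ * (η * ∑ i, ‖w l i‖) = η * ∑ l, ‖c l‖ * ∑ i, ‖w l i‖ := by
    rw [Finset.mul_sum]
    exact Finset.sum_congr rfl fun l _ => by ring
  linarith

lemma StableFam.exists_l1Lower_of_real (hE : StableFam ca cb E) (hδ : 0 < δ) {M : ℕ}
    (hM : 0 < M) {P : SNPair 𝕜 (M * M)} (hP : P ∈ E (M * M)) (hq : RealL1Lower δ P.2) :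
    ∃ Q ∈ E M, L1Lower (δ ^ 2 / (8 * ca)) Q.2 := by
  have hB := hE.1 _ P hP
  have hδca : δ ≤ ca := by
    have hMM : 0 < M * M := Nat.mul_pos hM hM
    refine le_trans (le_trans (le_of_eq ?_) (hq (Pi.single ⟨0, hMM⟩ 1)))
      (le_trans (le_of_eq ?_) (hB.snd_single_le ⟨0, hMM⟩))
    · rw [Finset.sum_eq_single_of_mem ⟨0, hMM⟩ (Finset.mem_univ _) fun i _ hi => by simp [hi]]
      simp
    · congr 1
      ext i
      by_cases h : i = ⟨0, hMM⟩ <;> simp [ofRealVec, h]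
  have hca : 0 < ca := hδ.trans_le hδca
  set η := δ ^ 2 / (8 * ca)
  have hη : 0 < η := by positivity
  have hηca : 8 * ca * η = δ ^ 2 := by
    simp only [η]
    field_simp
  have hηδ : 6 * η ≤ δ := by nlinarith
  by_cases hl : ∃ l : Fin M, ∀ b, η * ∑ i, ‖b i‖ ≤ P.2 (place (groupIndex l) b)
  · obtain ⟨l, hl⟩ := hl
    obtain ⟨Q, hQ, -, hQ2⟩ := hE.exists_place hP (strictMono_groupIndex l)
    exact ⟨Q, hQ, fun b => hQ2 b ▸ hl b⟩
  push Not at hl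
  choose b hb using hl
  set w := fun l => place (groupIndex l) (b l)
  have hw : Successive w := successive_place_groupIndex b
  have hsmall : ∀ l, P.2 (w l) < η * ∑ i, ‖w l i‖ := by
    intro l
    rw [sum_norm_place (strictMono_groupIndex l)]
    exact hb l
  set v : Fin M → Fin (M * M) → 𝕜 := fun l => ofRealVec fun i => RCLike.im (w l i)
  have hv : Successive v := by
    have : ∀ l i, v l i ≠ 0 → w l i ≠ 0 := by
      intro l i h h0
      exact h (by simp [v, ofRealVec, h0])
    exact fun j j' hj i i' hi hi' => hw j j' hj i i' (this j i hi) (this j' i' hi')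
  have hne : ∀ l, v l ≠ 0 := by
    intro l h0
    have h1 := seminorm_imVec_ge hδ.le hq (hsmall l).le
    change _ ≤ P.2 (v l) at h1
    rw [h0, map_zero] at h1
    have h2 : 0 < ∑ i, ‖w l i‖ :=
      pos_of_mul_pos_right ((apply_nonneg P.2 (w l)).trans_lt (hsmall l)) hη.le
    exact h1.not_gt (mul_pos (by linarith) h2)
  obtain ⟨Q, hQ, -, hQ2⟩ := hE.exists_normalize hP hv hne
  refine ⟨Q, hQ, fun c => ?_⟩
  have key := hq.sum_imVec hB hδ hca hηδ hηca.le hw (fun l => (hsmall l).le)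
    fun l => c l * (((P.1 (v l))⁻¹ : ℝ) : 𝕜)
  rw [hQ2]
  simp only [AsymSeminorms.normalize, ← mul_smul]
  refine le_trans ?_ key
  refine mul_le_mul_of_nonneg_left (Finset.sum_le_sum fun l _ => ?_) hη.le
  have hpos := hB.fst_pos (hne l)
  rw [norm_mul, RCLike.norm_ofReal, abs_of_pos (inv_pos.2 hpos), mul_assoc]
  refine le_mul_of_one_le_right (norm_nonneg _) ?_
  rw [inv_mul_eq_div, one_le_div hpos]
  refine (hB.fst_le _).trans (Finset.sum_le_sum fun i _ => ?_)
  simp only [v, ofRealVec, RCLike.norm_ofReal]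
  exact RCLike.abs_im_le_norm _

end RealToScalar

section RandomSigns

variable {𝕜 : Type*} [RCLike 𝕜] {n : ℕ}

/-- The vector `a` with the signs of its coordinates changed according to `ε`. -/
def signed (ε : Fin n → Bool) (a : Fin n → 𝕜) : Fin n → 𝕜 := fun i => sgn (ε i) * a i

lemma norm_sgn (b : Bool) : ‖(sgn b : 𝕜)‖ = 1 := by
  cases b <;> simp [sgn]

lemma norm_signed (ε : Fin n → Bool) (a : Fin n → 𝕜) (i : Fin n) : ‖signed ε a i‖ = ‖a i‖ := by
  simp [signed, norm_sgn]

lemma sum_signed_signed (q : (Fin n → 𝕜) → ℝ) (σ : Fin n → Bool) (a : Fin n → 𝕜) :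
    ∑ ε, q (signed σ (signed ε a)) = ∑ ε, q (signed ε a) := by
  let e : (Fin n → Bool) ≃ (Fin n → Bool) :=
    Function.Involutive.toPerm (fun ε i => xor (ε i) (!σ i)) fun ε => by
      funext i
      simp
  refine Fintype.sum_equiv e _ _ fun ε => congrArg q ?_
  ext i
  change sgn (σ i) * (sgn (ε i) * a i) = sgn (xor (ε i) (!σ i)) * a i
  cases σ i <;> cases ε i <;> simp [sgn]

/-- The restriction of `a` to the `l`-th group of `M` consecutive coordinates. -/
def grp (M l : ℕ) (a : Fin n → 𝕜) : Fin n → 𝕜 := fun i => if (i : ℕ) / M = l then a i else 0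

/-- The sum of `q (·) ^ p` over the groups of `M` consecutive coordinates. -/
def groupSum (q : Seminorm 𝕜 (Fin n → 𝕜)) (p : ℝ) (M : ℕ) (a : Fin n → 𝕜) : ℝ :=
  ∑ l ∈ Finset.range n, q (grp M l a) ^ p

variable {q : Seminorm 𝕜 (Fin n → 𝕜)} {p : ℝ}

lemma grp_eq_zero {M l : ℕ} (hl : n ≤ l) (a : Fin n → 𝕜) : grp M l a = 0 := by
  ext i
  have h : (i : ℕ) / M ≠ l := by
    have := Nat.div_le_self i M
    have := i.2
    omega
  simp [grp, h]

lemma sum_grp_le_groupSum (hp : 1 < p) (M : ℕ) (a : Fin n → 𝕜) (s : Finset ℕ) :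
    ∑ l ∈ s, q (grp M l a) ^ p ≤ groupSum q p M a := by
  rw [groupSum, ← Finset.sum_filter_add_sum_filter_not s (· < n),
    Finset.sum_eq_zero (s := s.filter fun l => ¬ l < n), add_zero]
  · refine Finset.sum_le_sum_of_subset_of_nonneg (fun l hl => ?_) fun l _ _ =>
      Real.rpow_nonneg (apply_nonneg _ _) _
    simpa using (Finset.mem_filter.1 hl).2
  · intro l hl
    rw [grp_eq_zero (not_lt.1 (Finset.mem_filter.1 hl).2), map_zero,
      Real.zero_rpow (by linarith)]

lemma groupSum_eq_sum_range (hp : 1 < p) (M : ℕ) (a : Fin n → 𝕜) {N : ℕ} (hN : n ≤ N) :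
    groupSum q p M a = ∑ l ∈ Finset.range N, q (grp M l a) ^ p := by
  refine le_antisymm ?_ (sum_grp_le_groupSum hp M a _)
  refine Finset.sum_le_sum_of_subset_of_nonneg (by simpa using hN) fun l _ _ =>
      Real.rpow_nonneg (apply_nonneg _ _) _

lemma sum_range_mul_eq (f : ℕ → ℝ) (N k : ℕ) :
    ∑ l ∈ Finset.range (N * k), f l = ∑ L ∈ Finset.range N, ∑ s : Fin k, f (L * k + s) := by
  induction N with
  | zero => simp
  | succ N ih =>
    rw [add_mul, one_mul, Finset.sum_range_add, ih, Finset.sum_range_succ,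
      Finset.sum_range (n := k)]

lemma groupSum_eq_sum_sum (hp : 1 < p) (M : ℕ) (a : Fin n → 𝕜) {k : ℕ} (hk : 0 < k) :
    groupSum q p M a =
      ∑ L ∈ Finset.range n, ∑ s : Fin k, q (grp M (L * k + s) a) ^ p := by
  rw [groupSum_eq_sum_range hp M a (Nat.le_mul_of_pos_right n hk),
    sum_range_mul_eq fun l => q (grp M l a) ^ p]

lemma groupSum_le {C : ℝ} (hp : 1 < p) (hC : ∀ i, q (Pi.single i 1) ≤ C) (hC0 : 0 ≤ C) {M : ℕ}
    (hM : 0 < M) (a : Fin n → 𝕜) :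
    groupSum q p M a ≤ C ^ p * (M : ℝ) ^ (p - 1) * ∑ i, ‖a i‖ ^ p := by
  have hmaps : ∀ i ∈ (Finset.univ : Finset (Fin n)), (i : ℕ) / M ∈ Finset.range n := fun i _ =>
    Finset.mem_range.2 ((Nat.div_le_self _ _).trans_lt i.2)
  rw [groupSum, Finset.mul_sum, ← Finset.sum_fiberwise_of_maps_to hmaps]
  refine Finset.sum_le_sum fun l _ => ?_
  set s := Finset.univ.filter fun i : Fin n => (i : ℕ) / M = l
  have hcard : s.card ≤ M := by
    have : s.card ≤ (Finset.Ico (l * M) (l * M + M)).card := by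
      refine Finset.card_le_card_of_injOn (fun i => (i : ℕ)) (fun i hi => ?_)
        Fin.val_injective.injOn
      have hi' : (i : ℕ) / M = l := by simpa [s] using hi
      rw [Nat.div_eq_iff hM] at hi'
      simp only [Finset.coe_Ico, Set.mem_Ico]
      omega
    simpa using this
  have h1 : q (grp M l a) ≤ ∑ i ∈ s, C * ‖a i‖ := by
    refine (seminorm_le_sum_single q _).trans ?_
    rw [Finset.sum_filter]
    refine Finset.sum_le_sum fun i _ => ?_
    simp only [grp]
    split_ifs
    · rw [mul_comm]
      exact mul_le_mul_of_nonneg_right (hC i) (norm_nonneg _)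
    · simp
  calc q (grp M l a) ^ p ≤ (∑ i ∈ s, C * ‖a i‖) ^ p :=
        Real.rpow_le_rpow (apply_nonneg _ _) h1 (by linarith)
    _ ≤ (s.card : ℝ) ^ (p - 1) * ∑ i ∈ s, (C * ‖a i‖) ^ p :=
        Real.rpow_sum_le_const_mul_sum_rpow_of_nonneg _ hp.le fun i _ =>
          mul_nonneg hC0 (norm_nonneg _)
    _ ≤ (M : ℝ) ^ (p - 1) * ∑ i ∈ s, (C * ‖a i‖) ^ p := by
        refine mul_le_mul_of_nonneg_right (Real.rpow_le_rpow (by positivity)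
          (by exact_mod_cast hcard) (by linarith)) (Finset.sum_nonneg fun i _ => by positivity)
    _ = ∑ i ∈ s, C ^ p * (M : ℝ) ^ (p - 1) * ‖a i‖ ^ p := by
        rw [Finset.mul_sum]
        refine Finset.sum_congr rfl fun i _ => ?_
        rw [Real.mul_rpow hC0 (norm_nonneg _)]
        ring

lemma seminorm_sum_rpow_le (hp : 1 < p) {ι : Type*} (s : Finset ι) (f : ι → Fin n → 𝕜) :
    q (∑ j ∈ s, f j) ^ p ≤ (s.card : ℝ) ^ (p - 1) * ∑ j ∈ s, q (f j) ^ p :=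
  (Real.rpow_le_rpow (apply_nonneg _ _) (seminorm_sum_le q s f) (by linarith)).trans
    (Real.rpow_sum_le_const_mul_sum_rpow_of_nonneg _ hp.le fun _ _ => apply_nonneg _ _)

lemma rpow_le_groupSum (hp : 1 < p) {M : ℕ} (hM : 0 < M) (hMn : M ≤ n) (a : Fin n → 𝕜) :
    q a ^ p ≤ (2 * n / M : ℝ) ^ (p - 1) * groupSum q p M a := by
  have ha : a = ∑ l ∈ Finset.range (n / M + 1), grp M l a := by
    ext i
    simp only [Finset.sum_apply, grp]
    rw [Finset.sum_ite_eq, if_pos]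
    exact Finset.mem_range.2 (Nat.lt_succ_of_le (Nat.div_le_div_right i.2.le))
  have hcard : ((n / M + 1 : ℕ) : ℝ) ≤ 2 * n / M := by
    have hM' : (0 : ℝ) < M := by exact_mod_cast hM
    rw [le_div_iff₀ hM']
    have h1 : (n / M + 1) * M ≤ 2 * n := by
      have := Nat.div_mul_le_self n M
      rw [add_mul]
      omega
    exact_mod_cast h1
  conv_lhs => rw [ha]
  refine (seminorm_sum_rpow_le hp _ _).trans ?_
  rw [Finset.card_range]
  refine mul_le_mul (Real.rpow_le_rpow (by positivity) hcard (by linarith))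
    (sum_grp_le_groupSum hp M a _) (Finset.sum_nonneg fun l _ =>
      Real.rpow_nonneg (apply_nonneg _ _) _) (by positivity)

/-- The choice of signs that is `σ s` on the `(L * k + s)`-th group of `M` coordinates. -/
def groupSigns (n M : ℕ) {k : ℕ} (hk : 0 < k) (σ : Fin k → Bool) : Fin n → Bool :=
  fun i => σ ⟨(i : ℕ) / M % k, Nat.mod_lt _ hk⟩

lemma grp_signed_groupSigns (M L : ℕ) {k : ℕ} (hk : 0 < k) (σ : Fin k → Bool)
    (a : Fin n → 𝕜) :
    grp (M * k) L (signed (groupSigns n M hk σ) a) =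
      ∑ s : Fin k, (sgn (σ s) : 𝕜) • grp M (L * k + s) a := by
  ext i
  simp only [grp, signed, groupSigns, Finset.sum_apply, Pi.smul_apply, smul_eq_mul]
  rw [← Nat.div_div_eq_div_mul]
  have hdm := Nat.div_add_mod ((i : ℕ) / M) k
  have hlt := Nat.mod_lt ((i : ℕ) / M) hk
  split_ifs with h
  · rw [Finset.sum_eq_single_of_mem ⟨(i : ℕ) / M % k, hlt⟩ (Finset.mem_univ _)]
    · rw [if_pos]
      change (i : ℕ) / M = L * k + (i : ℕ) / M % k
      rw [← h, mul_comm, hdm]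
    · intro s _ hs
      rw [if_neg, mul_zero]
      intro h'
      refine hs (Fin.ext ?_)
      change (s : ℕ) = (i : ℕ) / M % k
      rw [h', Nat.mul_add_mod_self_right, Nat.mod_eq_of_lt s.2]
  · refine (Finset.sum_eq_zero fun s _ => ?_).symm
    rw [if_neg, mul_zero]
    intro h'
    refine h ?_
    rw [h', mul_comm, Nat.mul_add_div hk, Nat.div_eq_of_lt s.2, add_zero]

lemma sum_groupSum_mul (p : ℝ) (M : ℕ) {k : ℕ} (hk : 0 < k) (a : Fin n → 𝕜) :
    2 ^ k * ∑ ε, groupSum q p (M * k) (signed ε a) =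
      ∑ ε, ∑ L ∈ Finset.range n, ∑ σ : Fin k → Bool,
        q (∑ s : Fin k, (sgn (σ s) : 𝕜) • grp M (L * k + s) (signed ε a)) ^ p := by
  have h : ∀ σ : Fin k → Bool, ∑ ε, groupSum q p (M * k) (signed ε a) =
      ∑ ε, ∑ L ∈ Finset.range n,
        q (∑ s : Fin k, (sgn (σ s) : 𝕜) • grp M (L * k + s) (signed ε a)) ^ p := by
    intro σ
    rw [← sum_signed_signed _ (groupSigns n M hk σ)]
    simp only [groupSum, grp_signed_groupSigns]
  have h2 := Finset.sum_congr rfl fun σ (_ : σ ∈ (Finset.univ : Finset (Fin k → Bool))) => h σ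
  rw [Finset.sum_const, Finset.card_univ, Fintype.card_fun, Fintype.card_bool, Fintype.card_fin,
    nsmul_eq_mul] at h2
  push_cast at h2
  rw [h2, Finset.sum_comm]
  exact Finset.sum_congr rfl fun ε _ => Finset.sum_comm

lemma exists_group_of_sum_ge {r : Seminorm 𝕜 (Fin n → 𝕜)} (hp : 1 < p) {M k : ℕ} (hk : 0 < k)
    (a : Fin n → 𝕜) {τ η W : ℝ} (hτ : 0 < τ) (hη : 0 < η) (hW : 0 < W)
    (h1 : τ * W ≤ ∑ ε, groupSum q p M (signed ε a))
    (h2 : ∑ ε, groupSum q p M (signed ε a) - η * W ≤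
      (∑ ε, groupSum q p (M * k) (signed ε a)) / (k : ℝ) ^ (p - 1))
    (h3 : ∑ ε, groupSum r p M (signed ε a) ≤ W) :
    ∃ (ε : Fin n → Bool) (L : ℕ), 0 <
      ∑ s : Fin k, q (grp M (L * k + s) (signed ε a)) ^ p
      - τ / (4 * η) * (∑ s : Fin k, q (grp M (L * k + s) (signed ε a)) ^ p
        - (∑ σ : Fin k → Bool, q (∑ s : Fin k, (sgn (σ s) : 𝕜) •
            grp M (L * k + s) (signed ε a)) ^ p) / (2 ^ k * (k : ℝ) ^ (p - 1)))
      - τ / 4 * ∑ s : Fin k, r (grp M (L * k + s) (signed ε a)) ^ p := by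
  by_contra! hcon
  have hsum := Finset.sum_nonpos fun ε (_ : ε ∈ (Finset.univ : Finset (Fin n → Bool))) =>
    Finset.sum_nonpos fun L (_ : L ∈ Finset.range n) => hcon ε L
  simp only [Finset.sum_sub_distrib, ← Finset.mul_sum, ← Finset.sum_div] at hsum
  simp only [← groupSum_eq_sum_sum hp M _ hk] at hsum
  rw [← sum_groupSum_mul p M hk a, mul_div_mul_left _ _ (by positivity)] at hsum
  have h4 : τ / (4 * η) * (∑ ε, groupSum q p M (signed ε a) -
      (∑ ε, groupSum q p (M * k) (signed ε a)) / (k : ℝ) ^ (p - 1)) ≤ τ / 4 * W := by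
    calc _ ≤ τ / (4 * η) * (η * W) := by
          refine mul_le_mul_of_nonneg_left (by linarith) (by positivity)
      _ = τ / 4 * W := by field_simp
  have h5 : τ / 4 * ∑ ε, groupSum r p M (signed ε a) ≤ τ / 4 * W := by gcongr
  have h6 : 0 < τ * W := mul_pos hτ hW
  linarith

end RandomSigns

section RealL1FromSigns

variable {𝕜 : Type*} [RCLike 𝕜] {n k : ℕ} {q r : Seminorm 𝕜 (Fin n → 𝕜)} {p : ℝ}

/-- The mean of order `p` of the values of `q` on `x`. -/
def powerMean (q : Seminorm 𝕜 (Fin n → 𝕜)) (p : ℝ) (x : Fin k → Fin n → 𝕜) : ℝ :=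
  ((∑ s, q (x s) ^ p) / k) ^ (1 / p)

variable {x : Fin k → Fin n → 𝕜}

lemma sum_rpow_nonneg : 0 ≤ ∑ s, q (x s) ^ p :=
  Finset.sum_nonneg fun _ _ => Real.rpow_nonneg (apply_nonneg _ _) _

lemma powerMean_nonneg : 0 ≤ powerMean q p x :=
  Real.rpow_nonneg (div_nonneg sum_rpow_nonneg (Nat.cast_nonneg k)) _

lemma powerMean_rpow (hp : 1 < p) : powerMean q p x ^ p = (∑ s, q (x s) ^ p) / k := by
  rw [powerMean, ← Real.rpow_mul (div_nonneg sum_rpow_nonneg (Nat.cast_nonneg k)),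
    one_div_mul_cancel (by linarith), Real.rpow_one]

lemma powerMean_pos (hk : 0 < k) (h : 0 < ∑ s, q (x s) ^ p) : 0 < powerMean q p x :=
  Real.rpow_pos_of_pos (div_pos h (by exact_mod_cast hk)) _

lemma mul_powerMean_rpow (hp : 1 < p) (hk : 0 < k) :
    (k * powerMean q p x) ^ p = (k : ℝ) ^ (p - 1) * ∑ s, q (x s) ^ p := by
  have hk' : (0 : ℝ) < k := by exact_mod_cast hk
  rw [Real.mul_rpow hk'.le powerMean_nonneg, powerMean_rpow hp, Real.rpow_sub_one hk'.ne']
  ring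

lemma sum_le_mul_powerMean (hp : 1 < p) (hk : 0 < k) :
    ∑ s, q (x s) ≤ k * powerMean q p x := by
  refine (Real.rpow_le_rpow_iff (Finset.sum_nonneg fun _ _ => apply_nonneg _ _)
    (mul_nonneg (Nat.cast_nonneg k) powerMean_nonneg) (by linarith : 0 < p)).1 ?_
  rw [mul_powerMean_rpow hp hk]
  simpa using Real.rpow_sum_le_const_mul_sum_rpow_of_nonneg (f := fun s => q (x s))
    Finset.univ hp.le fun _ _ => apply_nonneg _ _

lemma sum_erase_le_mul_powerMean (hp : 1 < p) (hk : 0 < k) (s : Fin k) :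
    ∑ s' ∈ Finset.univ.erase s, q (x s') ≤ (k - (1 - 1 / p)) * powerMean q p x := by
  have hp0 : 0 < p := by linarith
  have hk1 : (1 : ℝ) ≤ k := by exact_mod_cast hk
  have hp1 : 1 / p ≤ 1 := (div_le_one hp0).2 hp.le
  have hp2 : 0 ≤ 1 / p := by positivity
  set A := ∑ s, q (x s) ^ p with hA
  have hA0 : 0 ≤ A := sum_rpow_nonneg
  have hY0 : 0 ≤ ∑ s' ∈ Finset.univ.erase s, q (x s') :=
    Finset.sum_nonneg fun _ _ => apply_nonneg _ _
  have hY : (∑ s' ∈ Finset.univ.erase s, q (x s')) ^ p ≤ ((k : ℝ) - 1) ^ (p - 1) * A := by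
    refine (Real.rpow_sum_le_const_mul_sum_rpow_of_nonneg _ hp.le
      fun _ _ => apply_nonneg _ _).trans ?_
    rw [Finset.card_erase_of_mem (Finset.mem_univ _), Finset.card_univ, Fintype.card_fin,
      Nat.cast_sub hk, Nat.cast_one]
    refine mul_le_mul_of_nonneg_left (Finset.sum_le_sum_of_subset_of_nonneg
      (Finset.erase_subset _ _) fun _ _ _ => Real.rpow_nonneg (apply_nonneg _ _) _)
      (Real.rpow_nonneg (by linarith) _)
  have hgm := Real.geom_mean_le_arith_mean2_weighted (sub_nonneg.2 hp1) hp2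
    (sub_nonneg.2 hk1) (Nat.cast_nonneg k) (by ring)
  calc ∑ s' ∈ Finset.univ.erase s, q (x s')
      = ((∑ s' ∈ Finset.univ.erase s, q (x s')) ^ p) ^ (1 / p) := by
        rw [← Real.rpow_mul hY0, mul_one_div_cancel hp0.ne', Real.rpow_one]
    _ ≤ (((k : ℝ) - 1) ^ (p - 1) * A) ^ (1 / p) :=
        Real.rpow_le_rpow (Real.rpow_nonneg hY0 _) hY hp2
    _ = ((k : ℝ) - 1) ^ (1 - 1 / p) * (k : ℝ) ^ (1 / p) * powerMean q p x := by
        rw [Real.mul_rpow (Real.rpow_nonneg (by linarith) _) hA0,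
          ← Real.rpow_mul (by linarith), powerMean, ← hA, mul_assoc,
          ← Real.mul_rpow (by linarith) (by positivity), mul_div_cancel₀ _ (by linarith)]
        congr 2
        field_simp
    _ ≤ (k - (1 - 1 / p)) * powerMean q p x := by
        refine mul_le_mul_of_nonneg_right (hgm.trans_eq ?_) powerMean_nonneg
        ring

lemma seminorm_sum_sgn_rpow_le (hp : 1 < p) (σ : Fin k → Bool) :
    q (∑ s, (sgn (σ s) : 𝕜) • x s) ^ p ≤ (k : ℝ) ^ (p - 1) * ∑ s, q (x s) ^ p := by
  have h := seminorm_sum_rpow_le (q := q) hp Finset.univ fun s => (sgn (σ s) : 𝕜) • x s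
  simpa only [map_smul_eq_mul, norm_sgn, one_mul, Finset.card_univ, Fintype.card_fin] using h

lemma sum_sgn_rpow_div_le (hp : 1 < p) (hk : 0 < k) :
    (∑ σ : Fin k → Bool, q (∑ s, (sgn (σ s) : 𝕜) • x s) ^ p) / (2 ^ k * (k : ℝ) ^ (p - 1)) ≤
      ∑ s, q (x s) ^ p := by
  have hk' : (0 : ℝ) < k := by exact_mod_cast hk
  rw [div_le_iff₀ (by positivity)]
  refine (Finset.sum_le_sum fun σ _ => seminorm_sum_sgn_rpow_le hp σ).trans_eq ?_
  simp
  ring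

/-- If the `L_p`-average over signs of `q (∑ ± x s)` is nearly the maximal possible one, then
each of these values is. -/
lemma mul_powerMean_le_sum_sgn (hp : 1 < p) (hk : 0 < k) {ζ : ℝ} (hζ0 : 0 ≤ ζ) (hζ1 : ζ ≤ 1)
    (h : 2 ^ k * (∑ s, q (x s) ^ p - (∑ σ : Fin k → Bool,
      q (∑ s, (sgn (σ s) : 𝕜) • x s) ^ p) / (2 ^ k * (k : ℝ) ^ (p - 1))) ≤
        ζ * ∑ s, q (x s) ^ p) (σ : Fin k → Bool) :
    (1 - ζ) * (k * powerMean q p x) ≤ q (∑ s, (sgn (σ s) : 𝕜) • x s) := by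
  have hk' : (0 : ℝ) < k := by exact_mod_cast hk
  have hkp : (0 : ℝ) < (k : ℝ) ^ (p - 1) := by positivity
  have hkμ : 0 ≤ k * powerMean q p x := mul_nonneg hk'.le powerMean_nonneg
  refine (Real.rpow_le_rpow_iff (mul_nonneg (by linarith) hkμ) (apply_nonneg _ _)
    (by linarith : 0 < p)).1 ?_
  rw [Real.mul_rpow (by linarith) hkμ, mul_powerMean_rpow hp hk]
  have h1 : (1 - ζ) ^ p ≤ 1 - ζ :=
    Real.rpow_le_self_of_le_one (by linarith) (by linarith) hp.le
  have h2 : (k : ℝ) ^ (p - 1) * ∑ s, q (x s) ^ p - q (∑ s, (sgn (σ s) : 𝕜) • x s) ^ p ≤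
      ∑ σ : Fin k → Bool, ((k : ℝ) ^ (p - 1) * ∑ s, q (x s) ^ p -
        q (∑ s, (sgn (σ s) : 𝕜) • x s) ^ p) :=
    Finset.single_le_sum (f := fun σ : Fin k → Bool => (k : ℝ) ^ (p - 1) * ∑ s, q (x s) ^ p -
        q (∑ s, (sgn (σ s) : 𝕜) • x s) ^ p)
      (fun σ _ => sub_nonneg.2 (seminorm_sum_sgn_rpow_le hp σ)) (Finset.mem_univ σ)
  have h3 : ∑ σ : Fin k → Bool, ((k : ℝ) ^ (p - 1) * ∑ s, q (x s) ^ p -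
        q (∑ s, (sgn (σ s) : 𝕜) • x s) ^ p) =
      (k : ℝ) ^ (p - 1) * (2 ^ k * (∑ s, q (x s) ^ p - (∑ σ : Fin k → Bool,
      q (∑ s, (sgn (σ s) : 𝕜) • x s) ^ p) / (2 ^ k * (k : ℝ) ^ (p - 1)))) := by
    rw [Finset.sum_sub_distrib]
    simp only [Finset.sum_const, Finset.card_univ, Fintype.card_fun, Fintype.card_bool,
      Fintype.card_fin, nsmul_eq_mul]
    push_cast
    field_simp
  have h4 := mul_le_mul_of_nonneg_left h hkp.le
  have h5 := mul_le_mul_of_nonneg_right h1 (mul_nonneg hkp.le (sum_rpow_nonneg (q := q) (x := x)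
    (p := p)))
  linarith

lemma powerMean_le_apply (hp : 1 < p) (hk : 0 < k) {ζ : ℝ}
    (h : ∀ σ : Fin k → Bool,
      (1 - ζ) * (k * powerMean q p x) ≤ q (∑ s, (sgn (σ s) : 𝕜) • x s)) (s : Fin k) :
    (1 - 1 / p - k * ζ) * powerMean q p x ≤ q (x s) := by
  have h1 := (h fun _ => true).trans (seminorm_sum_le q _ _)
  simp only [sgn, if_true, one_smul] at h1
  rw [← Finset.add_sum_erase _ _ (Finset.mem_univ s)] at h1
  have h2 := sum_erase_le_mul_powerMean (q := q) (x := x) hp hk s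
  linarith

lemma powerMean_mul_sum_abs_le (hp : 1 < p) (hk : 0 < k) {ζ : ℝ} (hζ : 4 * (k * ζ) ≤ 1 - 1 / p)
    (h : ∀ σ : Fin k → Bool,
      (1 - ζ) * (k * powerMean q p x) ≤ q (∑ s, (sgn (σ s) : 𝕜) • x s)) (b : Fin k → ℝ) :
    (1 - 1 / p) / 2 * powerMean q p x * ∑ s, |b s| ≤ q (∑ s, (b s : 𝕜) • x s) := by
  set μ := powerMean q p x
  set B := ∑ s, |b s| with hB
  have hB0 : 0 ≤ B := Finset.sum_nonneg fun _ _ => abs_nonneg _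
  have hbB : ∀ s, |b s| ≤ B := fun s =>
    Finset.single_le_sum (f := fun s => |b s|) (fun _ _ => abs_nonneg _) (Finset.mem_univ s)
  let σ : Fin k → Bool := fun s => decide (0 ≤ b s)
  have hσ : ∀ s, (b s : 𝕜) = (|b s| : ℝ) * sgn (σ s) := by
    intro s
    by_cases hs : 0 ≤ b s
    · simp [σ, hs, sgn, abs_of_nonneg hs]
    · simp [σ, hs, sgn, abs_of_neg (not_le.1 hs)]
  have hsum : (B : 𝕜) • ∑ s, (sgn (σ s) : 𝕜) • x s =
      ∑ s, (b s : 𝕜) • x s + ∑ s, ((B - |b s| : ℝ) : 𝕜) • (sgn (σ s) : 𝕜) • x s := by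
    rw [← Finset.sum_add_distrib, Finset.smul_sum]
    refine Finset.sum_congr rfl fun s _ => ?_
    rw [hσ, mul_smul, ← add_smul, ← RCLike.ofReal_add]
    congr 2
    ring
  have h1 : B * ((1 - ζ) * (k * μ)) ≤
      q (∑ s, (b s : 𝕜) • x s) + ∑ s, (B - |b s|) * q (x s) := by
    calc B * ((1 - ζ) * (k * μ)) ≤ B * q (∑ s, (sgn (σ s) : 𝕜) • x s) :=
          mul_le_mul_of_nonneg_left (h σ) hB0
      _ = q ((B : 𝕜) • ∑ s, (sgn (σ s) : 𝕜) • x s) := (seminorm_ofReal_smul q hB0 _).symm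
      _ ≤ _ := by
          rw [hsum]
          refine (map_add_le_add q _ _).trans (add_le_add_right
            ((seminorm_sum_le q _ _).trans_eq (Finset.sum_congr rfl fun s _ => ?_)) _)
          rw [seminorm_ofReal_smul q (sub_nonneg.2 (hbB s)), map_smul_eq_mul, norm_sgn, one_mul]
  have h2 : ∑ s, (B - |b s|) * q (x s) ≤ B * (k * μ) - (1 - 1 / p - k * ζ) * μ * B := by
    have h3 : ∑ s, (B - |b s|) * q (x s) = B * ∑ s, q (x s) - ∑ s, |b s| * q (x s) := by
      simp only [sub_mul, Finset.sum_sub_distrib, Finset.mul_sum]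
    have h4 : (1 - 1 / p - k * ζ) * μ * B ≤ ∑ s, |b s| * q (x s) := by
      rw [hB, Finset.mul_sum]
      refine Finset.sum_le_sum fun s _ => ?_
      rw [mul_comm]
      exact mul_le_mul_of_nonneg_left (powerMean_le_apply hp hk h s) (abs_nonneg _)
    have h5 := mul_le_mul_of_nonneg_left (sum_le_mul_powerMean (q := q) (x := x) hp hk) hB0
    linarith
  have h6 : 0 ≤ ((1 - 1 / p) / 2 - 2 * (k * ζ)) * (μ * B) :=
    mul_nonneg (by linarith) (mul_nonneg powerMean_nonneg hB0)
  linarith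

variable {ca cb : ℝ} {E : Fam 𝕜}

lemma exists_strictMono_le_powerMean (hp : 1 < p) {m : ℕ} (hm : 0 < m)
    {x : Fin (2 * m) → Fin n → 𝕜} {C : ℝ} (hC : 0 < C) (hA : 0 < ∑ s, q (x s) ^ p)
    (hR : ∑ s, r (x s) ^ p ≤ C ^ p * ∑ s, q (x s) ^ p) :
    ∃ f : Fin m → Fin (2 * m), StrictMono f ∧ ∀ j, r (x (f j)) ≤ 2 * C * powerMean q p x := by
  have hk : 0 < 2 * m := by omega
  have hμ := powerMean_pos hk hA
  set μ := powerMean q p x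
  set good := Finset.univ.filter fun s => r (x s) ≤ 2 * C * μ
  set bad := Finset.univ.filter fun s => ¬ r (x s) ≤ 2 * C * μ
  have hcard : good.card + bad.card = 2 * m := by
    have := Finset.card_filter_add_card_filter_not (s := Finset.univ)
      fun s => r (x s) ≤ 2 * C * μ
    rwa [Finset.card_univ, Fintype.card_fin] at this
  have hbad : bad.card ≤ m := by
    have h1 : (bad.card : ℝ) * (2 * (C ^ p * μ ^ p)) ≤ C ^ p * ((2 * m : ℕ) * μ ^ p) := by
      calc (bad.card : ℝ) * (2 * (C ^ p * μ ^ p)) = ∑ s ∈ bad, 2 * (C ^ p * μ ^ p) := by simp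
        _ ≤ ∑ s ∈ bad, r (x s) ^ p := by
            refine Finset.sum_le_sum fun s hs => ?_
            have hs' : 2 * C * μ ≤ r (x s) := (not_le.1 (Finset.mem_filter.1 hs).2).le
            have h2 : (2 : ℝ) ≤ 2 ^ p := Real.self_le_rpow_of_one_le (by norm_num) hp.le
            calc 2 * (C ^ p * μ ^ p) ≤ 2 ^ p * (C ^ p * μ ^ p) := by gcongr
              _ = (2 * C * μ) ^ p := by
                  rw [Real.mul_rpow (by positivity) hμ.le, Real.mul_rpow (by norm_num) hC.le,
                    mul_assoc]
              _ ≤ r (x s) ^ p := Real.rpow_le_rpow (by positivity) hs' (by linarith)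
        _ ≤ ∑ s, r (x s) ^ p := Finset.sum_le_sum_of_subset_of_nonneg (Finset.subset_univ _)
            fun _ _ _ => Real.rpow_nonneg (apply_nonneg _ _) _
        _ ≤ C ^ p * ∑ s, q (x s) ^ p := hR
        _ = C ^ p * ((2 * m : ℕ) * μ ^ p) := by
            rw [powerMean_rpow hp, mul_div_cancel₀ _ (by exact_mod_cast hk.ne')]
    push_cast at h1
    have h3 : (0 : ℝ) < C ^ p * μ ^ p := by positivity
    have h4 : (bad.card : ℝ) ≤ m := by nlinarith
    exact_mod_cast h4
  refine ⟨Finset.orderEmbOfCardLe good (by omega), (Finset.orderEmbOfCardLe good _).strictMono,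
    fun j => ?_⟩
  exact (Finset.mem_filter.1 (Finset.orderEmbOfCardLe_mem good (by omega) j)).2

lemma Successive.comp {m : ℕ} {x : Fin k → Fin n → 𝕜} (hx : Successive x) {f : Fin m → Fin k}
    (hf : StrictMono f) : Successive fun j => x (f j) := fun _ _ hj => hx _ _ (hf hj)

lemma successive_grp (M L k : ℕ) (a : Fin n → 𝕜) :
    Successive fun s : Fin k => grp M (L * k + s) a := by
  intro s s' hs i i' hi hi'
  simp only [grp, ne_eq, ite_eq_right_iff, Classical.not_imp] at hi hi'
  by_contra h
  have h1 : (i' : ℕ) / M ≤ (i : ℕ) / M := Nat.div_le_div_right (not_lt.1 h)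
  have h2 : (s : ℕ) < s' := hs
  omega

lemma StableFam.exists_realL1Lower_of_sum_sgn (hE : StableFam ca cb E) {P : SNPair 𝕜 n}
    (hP : P ∈ E n) (hp : 1 < p) {m : ℕ} (hm : 0 < m) {x : Fin (2 * m) → Fin n → 𝕜}
    (hx : Successive x) {ζ : ℝ} (hζ0 : 0 ≤ ζ) (hζ : 4 * ((2 * m : ℕ) * ζ) ≤ 1 - 1 / p) {C : ℝ}
    (hC : 0 < C) (hA : 0 < ∑ s, P.2 (x s) ^ p)
    (h : ∀ σ : Fin (2 * m) → Bool,
      (1 - ζ) * ((2 * m : ℕ) * powerMean P.2 p x) ≤ P.2 (∑ s, (sgn (σ s) : 𝕜) • x s))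
    (hR : ∑ s, P.1 (x s) ^ p ≤ C ^ p * ∑ s, P.2 (x s) ^ p) :
    ∃ Q ∈ E m, RealL1Lower ((1 - 1 / p) / (4 * C)) Q.2 := by
  have hk : 0 < 2 * m := by omega
  have hμ := powerMean_pos hk hA
  have hp0 : 0 < p := by linarith
  have hα : 0 < 1 - 1 / p := sub_pos.2 ((div_lt_one hp0).2 hp)
  obtain ⟨f, hf, hfr⟩ := exists_strictMono_le_powerMean hp hm hC hA hR
  have hne : ∀ j, x (f j) ≠ 0 := by
    intro j h0
    have h1 := powerMean_le_apply hp hk h (f j)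
    rw [h0, map_zero] at h1
    have : 0 < (1 - 1 / p - (2 * m : ℕ) * ζ) * powerMean P.2 p x := by
      refine mul_pos ?_ hμ
      have : 0 ≤ ((2 * m : ℕ) : ℝ) * ζ := by positivity
      linarith
    linarith
  obtain ⟨Q, hQ, -, hQ2⟩ := hE.exists_normalize hP (hx.comp hf) hne
  refine ⟨Q, hQ, fun c => ?_⟩
  let b : Fin (2 * m) → ℝ := Function.extend f (fun j => (P.1 (x (f j)))⁻¹ * c j) 0
  have hb : ∀ j, b (f j) = (P.1 (x (f j)))⁻¹ * c j := fun j => hf.injective.extend_apply _ _ j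
  have hb0 : ∀ s, s ∉ Set.range f → b s = 0 := fun s hs =>
    Function.extend_apply' _ _ _ fun ⟨j, hj⟩ => hs ⟨j, hj⟩
  have h1 := powerMean_mul_sum_abs_le hp hk hζ h b
  have h2 : ∑ j, (ofRealVec c : Fin m → 𝕜) j • normalize P.1 (x (f j)) =
      ∑ s, (b s : 𝕜) • x s := by
    refine Fintype.sum_of_injective f hf.injective _ _ (fun s hs => by simp [hb0 s hs])
      fun j => ?_
    rw [hb, ofRealVec, normalize, smul_smul]
    push_cast
    rw [mul_comm]
  have h3 : ∑ j, |(P.1 (x (f j)))⁻¹ * c j| = ∑ s, |b s| :=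
    Fintype.sum_of_injective f hf.injective _ _ (fun s hs => by simp [hb0 s hs])
      fun j => by rw [hb]
  rw [hQ2, h2]
  refine le_trans ?_ h1
  rw [← h3, Finset.mul_sum, Finset.mul_sum]
  refine Finset.sum_le_sum fun j _ => ?_
  have hr : 0 < P.1 (x (f j)) := (hE.1 n P hP).fst_pos (hne j)
  rw [abs_mul, abs_of_pos (inv_pos.2 hr), ← mul_assoc]
  refine mul_le_mul_of_nonneg_right ?_ (abs_nonneg _)
  rw [← div_eq_mul_inv, div_le_div_iff₀ (by positivity) hr]
  have := mul_le_mul_of_nonneg_left (hfr j) hα.le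
  linarith

lemma StableFam.exists_realL1Lower_of_group (hE : StableFam ca cb E) {P : SNPair 𝕜 n}
    (hP : P ∈ E n) (hp : 1 < p) {m : ℕ} (hm : 0 < m) {x : Fin (2 * m) → Fin n → 𝕜}
    (hx : Successive x) {ζ τ η : ℝ} (hζ0 : 0 ≤ ζ) (hζ : 4 * ((2 * m : ℕ) * ζ) ≤ 1 - 1 / p)
    (hτ : 0 < τ) (hη : 0 < η) (hητ : 2 ^ (2 * m) * (4 * η) ≤ ζ * τ)
    (h : 0 < ∑ s, P.2 (x s) ^ p
      - τ / (4 * η) * (∑ s, P.2 (x s) ^ p - (∑ σ : Fin (2 * m) → Bool,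
        P.2 (∑ s, (sgn (σ s) : 𝕜) • x s) ^ p) / (2 ^ (2 * m) * ((2 * m : ℕ) : ℝ) ^ (p - 1)))
      - τ / 4 * ∑ s, P.1 (x s) ^ p) :
    ∃ Q ∈ E m, RealL1Lower ((1 - 1 / p) / (4 * (4 / τ) ^ (1 / p))) Q.2 := by
  have hk : 0 < 2 * m := by omega
  have hp0 : 0 < p := by linarith
  have hD := sub_nonneg.2 (sum_sgn_rpow_div_le (q := P.2) (x := x) hp hk)
  set A := ∑ s, P.2 (x s) ^ p
  set D := A - (∑ σ : Fin (2 * m) → Bool,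
        P.2 (∑ s, (sgn (σ s) : 𝕜) • x s) ^ p) / (2 ^ (2 * m) * ((2 * m : ℕ) : ℝ) ^ (p - 1))
    with hDdef
  have hR0 : 0 ≤ ∑ s, P.1 (x s) ^ p := sum_rpow_nonneg
  have hD' : 0 ≤ τ / (4 * η) * D := mul_nonneg (by positivity) hD
  have hR' : 0 ≤ τ / 4 * ∑ s, P.1 (x s) ^ p := mul_nonneg (by positivity) hR0
  have hA : 0 < A := by linarith
  have hk1 : (1 : ℝ) ≤ (2 * m : ℕ) := by exact_mod_cast hk
  have hp1 : 0 < 1 / p := by positivity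
  have hζ1 : ζ ≤ 1 := by nlinarith
  have hDA : 2 ^ (2 * m) * D ≤ ζ * A := by
    have h1 : τ * D ≤ 4 * η * A := by
      have h2 : τ / (4 * η) * D ≤ A := by linarith
      rw [div_mul_eq_mul_div, div_le_iff₀ (by positivity)] at h2
      linarith
    have h3 : τ * (2 ^ (2 * m) * D) ≤ τ * (ζ * A) := by
      calc τ * (2 ^ (2 * m) * D) = 2 ^ (2 * m) * (τ * D) := by ring
        _ ≤ 2 ^ (2 * m) * (4 * η * A) := by gcongr
        _ = 2 ^ (2 * m) * (4 * η) * A := by ring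
        _ ≤ ζ * τ * A := by gcongr
        _ = τ * (ζ * A) := by ring
    exact le_of_mul_le_mul_left h3 hτ
  refine hE.exists_realL1Lower_of_sum_sgn hP hp hm hx hζ0 hζ (by positivity) hA
    (mul_powerMean_le_sum_sgn hp hk hζ0 hζ1 hDA) ?_
  rw [← Real.rpow_mul (by positivity), one_div_mul_cancel hp0.ne', Real.rpow_one,
    div_mul_eq_mul_div, le_div_iff₀ hτ]
  linarith

lemma exists_sub_succ_le {S : ℕ → ℝ} {c d : ℝ} {J : ℕ} (hJ : 0 < J) (h0 : S 0 ≤ c)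
    (h : ∀ j, 0 ≤ S j) (hd : c ≤ J * d) : ∃ j < J, S j - S (j + 1) ≤ d := by
  by_contra! hcon
  have h1 : ∑ _j ∈ Finset.range J, d < ∑ j ∈ Finset.range J, (S j - S (j + 1)) :=
    Finset.sum_lt_sum_of_nonempty (Finset.nonempty_range_iff.2 hJ.ne') fun j hj =>
      hcon j (Finset.mem_range.1 hj)
  rw [Finset.sum_range_sub', Finset.sum_const, Finset.card_range, nsmul_eq_mul] at h1
  linarith [h J]

lemma groupSum_nonneg (M : ℕ) (a : Fin n → 𝕜) : 0 ≤ groupSum q p M a :=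
  Finset.sum_nonneg fun _ _ => Real.rpow_nonneg (apply_nonneg _ _) _

lemma sum_groupSum_signed_le {C : ℝ} (hp : 1 < p) (hC : ∀ i, q (Pi.single i 1) ≤ C)
    (hC0 : 0 ≤ C) {M : ℕ} (hM : 0 < M) (a : Fin n → 𝕜) :
    ∑ ε, groupSum q p M (signed ε a) ≤
      C ^ p * (2 ^ n * (M : ℝ) ^ (p - 1) * ∑ i, ‖a i‖ ^ p) := by
  have h : ∀ ε : Fin n → Bool, groupSum q p M (signed ε a) ≤
      C ^ p * (M : ℝ) ^ (p - 1) * ∑ i, ‖a i‖ ^ p := fun ε => by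
    simpa only [norm_signed] using groupSum_le hp hC hC0 hM (signed ε a)
  refine (Finset.sum_le_sum fun ε _ => h ε).trans_eq ?_
  simp
  ring

/-- If the inequalities defining subtype `p` fail with a constant of the maximal order, then `E`
contains sequences whose real combinations are bounded below by a multiple of the `ℓ₁`-norm. -/
lemma StableFam.exists_realL1Lower (hE : StableFam ca cb E) (hca : 0 ≤ ca) (hp : 1 < p) {κ : ℝ}
    (hκ : 0 < κ) : ∃ ϱ : ℝ, 0 < ϱ ∧ ∀ m : ℕ, 0 < m → ∃ N : ℕ, ∀ n, N ≤ n → ∀ P ∈ E n,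
      ∀ a : Fin n → 𝕜,
        2 ^ n * κ * (n : ℝ) ^ (p - 1) * ∑ i, ‖a i‖ ^ p < ∑ ε, P.2 (signed ε a) ^ p →
        ∃ Q ∈ E m, RealL1Lower ϱ Q.2 := by
  have hp0 : 0 < p := by linarith
  have hα : 0 < 1 - 1 / p := sub_pos.2 ((div_lt_one hp0).2 hp)
  set τ := κ / 2 ^ (p - 1) with hτdef
  have hτ : 0 < τ := by positivity
  refine ⟨(1 - 1 / p) / (4 * (4 / τ) ^ (1 / p)), by positivity, fun m hm => ?_⟩
  set k := 2 * m with hkdef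
  have hk : 0 < k := by omega
  have hk' : (0 : ℝ) < k := by exact_mod_cast hk
  set ζ := (1 - 1 / p) / (4 * k) with hζdef
  have hζ : 0 < ζ := by positivity
  set η := ζ * τ / (2 ^ k * 4) with hηdef
  have hη : 0 < η := by positivity
  set J := ⌈ca ^ p / η⌉₊ + 1 with hJdef
  have hJ : ca ^ p ≤ J * η := by
    rw [← div_le_iff₀ hη, hJdef]
    push_cast
    linarith [Nat.le_ceil (ca ^ p / η)]
  refine ⟨k ^ J, fun n hn P hP a hlt => ?_⟩
  set H := ∑ i, ‖a i‖ ^ p with hHdef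
  have hH : 0 < H := by
    refine lt_of_le_of_ne (Finset.sum_nonneg fun i _ => by positivity) fun h0 => ?_
    have ha : a = 0 := by
      ext i
      have h1 := (Finset.sum_eq_zero_iff_of_nonneg fun i _ => by positivity).1
        (hHdef.symm.trans h0.symm) i (Finset.mem_univ i)
      simpa [Real.rpow_eq_zero (norm_nonneg _) hp0.ne'] using h1
    have h2 : ∀ ε, signed ε a = 0 := fun ε => by
      ext i
      simp [signed, ha]
    simp [← h0, h2, Real.zero_rpow hp0.ne'] at hlt
  set G : ℕ → ℝ := fun j => ∑ ε, groupSum P.2 p (k ^ j) (signed ε a) with hG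
  have hG0 : ∀ j, 0 ≤ G j := fun j => Finset.sum_nonneg fun ε _ => groupSum_nonneg _ _
  have hB := hE.1 n P hP
  obtain ⟨j, hjJ, hj⟩ := exists_sub_succ_le (S := fun j => G j / ((k ^ j : ℕ) : ℝ) ^ (p - 1))
    (c := ca ^ p * (2 ^ n * H)) (d := η * (2 ^ n * H)) (J := J) (by omega)
    (by simpa [hG] using sum_groupSum_signed_le (M := 1) hp hB.snd_single_le hca one_pos a)
    (fun j => div_nonneg (hG0 j) (by positivity))
    (by
      have h1 := mul_le_mul_of_nonneg_right hJ (show 0 ≤ 2 ^ n * H by positivity)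
      linarith)
  have hMn : k ^ j ≤ n := (Nat.pow_le_pow_right hk hjJ.le).trans hn
  have hM : 0 < k ^ j := by positivity
  have hM' : (0 : ℝ) < (k ^ j : ℕ) := by exact_mod_cast hM
  have hn' : (0 : ℝ) < n := by exact_mod_cast hM.trans_le hMn
  obtain ⟨ε, L, h⟩ := exists_group_of_sum_ge (q := P.2) (r := P.1) hp (M := k ^ j) hk a
    (W := 2 ^ n * ((k ^ j : ℕ) : ℝ) ^ (p - 1) * H) hτ hη (by positivity)
    (by
      have h1 : ∑ ε, P.2 (signed ε a) ^ p ≤ (2 * n / (k ^ j : ℕ) : ℝ) ^ (p - 1) * G j := by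
        rw [hG, Finset.mul_sum]
        exact Finset.sum_le_sum fun ε _ => rpow_le_groupSum hp hM hMn _
      have h2 := hlt.le.trans h1
      rw [Real.div_rpow (by positivity) hM'.le, Real.mul_rpow (by norm_num) hn'.le,
        div_mul_eq_mul_div, le_div_iff₀ (by positivity)] at h2
      rw [hτdef, div_mul_eq_mul_div, div_le_iff₀ (by positivity)]
      refine le_of_mul_le_mul_left ?_ (Real.rpow_pos_of_pos hn' (p - 1))
      linarith)
    (by
      have h1 := mul_le_mul_of_nonneg_right hj
        (Real.rpow_nonneg (Nat.cast_nonneg (k ^ j)) (p - 1))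
      have h2 : G (j + 1) / ((k ^ (j + 1) : ℕ) : ℝ) ^ (p - 1) * ((k ^ j : ℕ) : ℝ) ^ (p - 1) =
          G (j + 1) / (k : ℝ) ^ (p - 1) := by
        rw [pow_succ, Nat.cast_mul, Real.mul_rpow hM'.le hk'.le]
        field_simp
      rw [sub_mul, h2, div_mul_cancel₀ _ (by positivity)] at h1
      change G j - _ ≤ G (j + 1) / _
      linarith)
    (by
      simpa using sum_groupSum_signed_le (M := k ^ j) hp
        (fun i => (hB.single_eq_one i).le) zero_le_one hM a)
  refine hE.exists_realL1Lower_of_group hP hp hm (successive_grp _ L _ _) hζ.le ?_ hτ hη ?_ h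
  · rw [← hkdef, hζdef]
    apply le_of_eq
    field_simp
  · rw [← hkdef, hηdef]
    apply le_of_eq
    field_simp

end RealL1FromSigns

section Constants

variable {𝕜 : Type*} [RCLike 𝕜] {ca cb : ℝ} {E : Fam 𝕜} {n : ℕ} {p : ℝ}

lemma lpnorm_ofReal (hp : 1 < p) (a : Fin n → 𝕜) :
    lpnorm (ENNReal.ofReal p) a = (∑ i, ‖a i‖ ^ p) ^ (1 / p) := by
  rw [lpnorm, if_neg ENNReal.ofReal_ne_top, ENNReal.toReal_ofReal (by linarith)]

lemma lpnorm_top (a : Fin n → 𝕜) : lpnorm ∞ a = ⨆ i, ‖a i‖ := if_pos rfl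

lemma norm_le_lpnorm_top (a : Fin n → 𝕜) (i : Fin n) : ‖a i‖ ≤ lpnorm ∞ a := by
  rw [lpnorm_top]
  exact le_ciSup (f := fun i => ‖a i‖) (Set.finite_range _).bddAbove i

lemma lpnorm_top_nonneg (a : Fin n → 𝕜) : 0 ≤ lpnorm ∞ a := by
  rw [lpnorm_top]
  exact Real.iSup_nonneg fun i => norm_nonneg _

lemma norm_le_lpnorm_ofReal (hp : 1 < p) (a : Fin n → 𝕜) (i : Fin n) :
    ‖a i‖ ≤ lpnorm (ENNReal.ofReal p) a := by
  have hp0 : 0 < p := by linarith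
  rw [lpnorm_ofReal hp]
  calc ‖a i‖ = (‖a i‖ ^ p) ^ (1 / p) := by
        rw [← Real.rpow_mul (norm_nonneg _), mul_one_div_cancel hp0.ne', Real.rpow_one]
    _ ≤ _ := Real.rpow_le_rpow (by positivity) (Finset.single_le_sum
        (f := fun i => ‖a i‖ ^ p) (fun i _ => by positivity) (Finset.mem_univ i)) (by positivity)

lemma lpnorm_ofReal_le (hp : 1 < p) (a : Fin n → 𝕜) :
    lpnorm (ENNReal.ofReal p) a ≤ (n : ℝ) ^ (1 / p) * lpnorm ∞ a := by
  have hp0 : 0 < p := by linarith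
  have h0 := lpnorm_top_nonneg a
  rw [lpnorm_ofReal hp]
  have h1 : ∑ i, ‖a i‖ ^ p ≤ n * lpnorm ∞ a ^ p := by
    refine (Finset.sum_le_sum fun i _ =>
      Real.rpow_le_rpow (norm_nonneg _) (norm_le_lpnorm_top a i) hp0.le).trans_eq ?_
    simp
  refine (Real.rpow_le_rpow (Finset.sum_nonneg fun i _ => by positivity) h1
    (by positivity)).trans_eq ?_
  rw [Real.mul_rpow (by positivity) (by positivity), ← Real.rpow_mul h0,
    mul_one_div_cancel hp0.ne', Real.rpow_one]

lemma radLp_ofReal (hp : 1 < p) (F : (Fin n → Bool) → ℝ) :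
    radLp (ENNReal.ofReal p) F = ((∑ ε, |F ε| ^ p) / 2 ^ n) ^ (1 / p) := by
  rw [radLp, if_neg ENNReal.ofReal_ne_top, ENNReal.toReal_ofReal (by linarith)]

lemma radLp_one (F : (Fin n → Bool) → ℝ) : radLp 1 F = (∑ ε, |F ε|) / 2 ^ n := by
  simp [radLp]

lemma radLp_ofReal_le (hp : 1 < p) {F : (Fin n → Bool) → ℝ} {C : ℝ} (hC : 0 ≤ C)
    (hF : ∀ ε, |F ε| ≤ C) : radLp (ENNReal.ofReal p) F ≤ C := by
  have hp0 : 0 < p := by linarith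
  rw [radLp_ofReal hp]
  have h1 : (∑ ε, |F ε| ^ p) / 2 ^ n ≤ C ^ p := by
    rw [div_le_iff₀ (by positivity)]
    refine (Finset.sum_le_sum fun ε _ =>
      Real.rpow_le_rpow (abs_nonneg _) (hF ε) hp0.le).trans_eq ?_
    simp
    ring
  refine (Real.rpow_le_rpow (div_nonneg (Finset.sum_nonneg fun _ _ => by positivity)
    (by positivity)) h1 (by positivity)).trans_eq ?_
  rw [← Real.rpow_mul hC, mul_one_div_cancel hp0.ne', Real.rpow_one]

lemma radLp_one_le {F : (Fin n → Bool) → ℝ} {C : ℝ} (hF : ∀ ε, |F ε| ≤ C) :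
    radLp 1 F ≤ C := by
  rw [radLp_one, div_le_iff₀ (by positivity)]
  refine (Finset.sum_le_sum fun ε _ => hF ε).trans_eq ?_
  simp
  ring

lemma le_radLp_one {F : (Fin n → Bool) → ℝ} {C : ℝ} (hF : ∀ ε, C ≤ |F ε|) :
    C ≤ radLp 1 F := by
  rw [radLp_one, le_div_iff₀ (by positivity)]
  refine le_of_eq_of_le ?_ (Finset.sum_le_sum fun ε _ => hF ε)
  simp
  ring

lemma radLp_one_le_radLp_ofReal (hp : 1 < p) (F : (Fin n → Bool) → ℝ) :
    radLp 1 F ≤ radLp (ENNReal.ofReal p) F := by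
  have hp0 : 0 < p := by linarith
  rw [radLp_one, radLp_ofReal hp]
  have h := Real.arith_mean_le_rpow_mean Finset.univ
    (fun _ : Fin n → Bool => ((2 : ℝ) ^ n)⁻¹) (fun ε => |F ε|) (fun _ _ => by positivity)
    (by simp) (fun _ _ => abs_nonneg _) hp.le
  simpa only [inv_mul_eq_div, ← Finset.sum_div] using h

lemma radLp_one_mul {F : (Fin n → Bool) → ℝ} {c : ℝ} (hc : 0 ≤ c) :
    radLp 1 (fun ε => c * F ε) = c * radLp 1 F := by
  simp only [radLp_one, abs_mul, abs_of_nonneg hc, ← Finset.mul_sum, mul_div_assoc]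

lemma MemB.snd_signed_le {P : SNPair 𝕜 n} (h : MemB ca cb P) (hca : 0 ≤ ca)
    (ε : Fin n → Bool) (a : Fin n → 𝕜) : P.2 (signed ε a) ≤ ca * ∑ i, ‖a i‖ := by
  refine (h.snd_le _).trans (mul_le_mul_of_nonneg_left ((h.fst_le _).trans_eq ?_) hca)
  simp only [norm_signed]

lemma snd_inv_smul (q : Seminorm 𝕜 (Fin n → 𝕜)) (v : Fin n → 𝕜) :
    q ((n : 𝕜)⁻¹ • v) = (n : ℝ)⁻¹ * q v := by
  rw [map_smul_eq_mul, norm_inv, RCLike.norm_natCast]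

lemma tauC_set_nonempty (hE : SubB ca cb E) (hca : 0 ≤ ca) (hp : 1 < p) (n : ℕ) :
    {T : ℝ | 0 < T ∧ ∀ P ∈ E n, ∀ a : Fin n → 𝕜,
      radLp (ENNReal.ofReal p) (fun ε => P.2 (fun i => sgn (ε i) * a i)) ≤
        T * lpnorm (ENNReal.ofReal p) a}.Nonempty := by
  refine ⟨ca * n + 1, by positivity, fun P hP a => ?_⟩
  have h0 : 0 ≤ lpnorm (ENNReal.ofReal p) a := by
    rw [lpnorm_ofReal hp]
    exact Real.rpow_nonneg (Finset.sum_nonneg fun i _ => by positivity) _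
  refine radLp_ofReal_le hp (by positivity) fun ε => ?_
  rw [abs_of_nonneg (apply_nonneg _ _)]
  refine ((hE n P hP).snd_signed_le hca ε a).trans ?_
  have h1 : ∑ i, ‖a i‖ ≤ n * lpnorm (ENNReal.ofReal p) a := by
    refine (Finset.sum_le_sum fun i _ => norm_le_lpnorm_ofReal hp a i).trans_eq ?_
    simp
  have h2 := mul_le_mul_of_nonneg_left h1 hca
  linarith

lemma bigThetaC_set_nonempty (hE : SubB ca cb E) (hca : 0 ≤ ca) (n : ℕ) :
    {T : ℝ | 0 < T ∧ ∀ P ∈ E n, ∀ a : Fin n → 𝕜,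
      radLp 1 (fun ε => P.2 ((n : 𝕜)⁻¹ • fun i => sgn (ε i) * a i)) ≤
        T * lpnorm ∞ a}.Nonempty := by
  refine ⟨ca + 1, by positivity, fun P hP a => ?_⟩
  have h0 := lpnorm_top_nonneg a
  refine radLp_one_le fun ε => ?_
  rw [abs_of_nonneg (apply_nonneg _ _), snd_inv_smul]
  have h1 := (hE n P hP).snd_signed_le hca ε a
  have h2 : ∑ i, ‖a i‖ ≤ n * lpnorm ∞ a := by
    refine (Finset.sum_le_sum fun i _ => norm_le_lpnorm_top a i).trans_eq ?_
    simp
  have h3 : (n : ℝ)⁻¹ * n ≤ 1 := inv_mul_le_one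
  calc (n : ℝ)⁻¹ * P.2 (signed ε a) ≤ (n : ℝ)⁻¹ * (ca * (n * lpnorm ∞ a)) := by
        gcongr
        exact h1.trans (by gcongr)
    _ = ((n : ℝ)⁻¹ * n) * (ca * lpnorm ∞ a) := by ring
    _ ≤ 1 * (ca * lpnorm ∞ a) := by gcongr
    _ ≤ (ca + 1) * lpnorm ∞ a := by linarith

lemma tauC_nonneg : 0 ≤ tauC (ENNReal.ofReal p) E n := Real.sInf_nonneg fun _ h => h.1.le

lemma bigThetaC_nonneg : 0 ≤ bigThetaC E n := Real.sInf_nonneg fun _ h => h.1.le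

lemma bigThetaC_le_tauC (hE : SubB ca cb E) (hca : 0 ≤ ca) (hp : 1 < p) (hn : 0 < n) :
    bigThetaC E n ≤ (n : ℝ) ^ (1 / p - 1) * tauC (ENNReal.ofReal p) E n := by
  have hn' : (0 : ℝ) < n := by exact_mod_cast hn
  have hc : 0 < (n : ℝ) ^ (1 / p - 1) := by positivity
  rw [mul_comm, ← div_le_iff₀ hc, tauC]
  refine le_csInf (tauC_set_nonempty hE hca hp n) fun T hT => ?_
  rw [div_le_iff₀ hc]
  refine csInf_le ⟨0, fun _ h => h.1.le⟩ ⟨mul_pos hT.1 hc, fun P hP a => ?_⟩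
  simp only [snd_inv_smul]
  rw [radLp_one_mul (by positivity)]
  have hT0 := hT.1
  calc (n : ℝ)⁻¹ * radLp 1 (fun ε => P.2 (fun i => sgn (ε i) * a i))
      ≤ (n : ℝ)⁻¹ * (T * ((n : ℝ) ^ (1 / p) * lpnorm ∞ a)) := by
        gcongr
        refine (radLp_one_le_radLp_ofReal hp _).trans ((hT.2 P hP a).trans ?_)
        gcongr
        exact lpnorm_ofReal_le hp a
    _ = T * (n : ℝ) ^ (1 / p - 1) * lpnorm ∞ a := by
        rw [Real.rpow_sub_one hn'.ne']
        ring

lemma IsL1Seq.le_bigThetaC (hE : SubB ca cb E) (hca : 0 ≤ ca) (hn : 0 < n) {P : SNPair 𝕜 n}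
    (hP : P ∈ E n) {ϱ : ℝ} (h : IsL1Seq ϱ P) : ϱ ≤ bigThetaC E n := by
  have hn' : (0 : ℝ) < n := by exact_mod_cast hn
  have : Nonempty (Fin n) := ⟨⟨0, hn⟩⟩
  refine le_csInf (bigThetaC_set_nonempty hE hca n) fun T hT => ?_
  have h1 := hT.2 P hP fun _ => 1
  have h2 : lpnorm ∞ (fun _ : Fin n => (1 : 𝕜)) = 1 := by simp [lpnorm_top]
  rw [h2, mul_one] at h1
  refine le_trans (le_radLp_one fun ε => ?_) h1
  rw [abs_of_nonneg (apply_nonneg _ _), snd_inv_smul, ← div_eq_inv_mul, le_div_iff₀ hn']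
  simpa [norm_sgn] using h fun i => sgn (ε i) * 1

lemma exists_sum_signed_gt_of_lt_tauC (hp : 1 < p) (hn : 0 < n) {t : ℝ} (ht : 0 < t)
    (h : t < (n : ℝ) ^ (1 / p - 1) * tauC (ENNReal.ofReal p) E n) :
    ∃ P ∈ E n, ∃ a : Fin n → 𝕜,
      2 ^ n * t ^ p * (n : ℝ) ^ (p - 1) * ∑ i, ‖a i‖ ^ p < ∑ ε, P.2 (signed ε a) ^ p := by
  have hp0 : 0 < p := by linarith
  have hn' : (0 : ℝ) < n := by exact_mod_cast hn
  have hT0 : 0 < t * (n : ℝ) ^ (1 - 1 / p) := by positivity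
  have hT : t * (n : ℝ) ^ (1 - 1 / p) < tauC (ENNReal.ofReal p) E n := by
    have h1 := mul_lt_mul_of_pos_right h (show 0 < (n : ℝ) ^ (1 - 1 / p) by positivity)
    rwa [mul_right_comm, ← Real.rpow_add hn', sub_add_sub_cancel', sub_self,
      Real.rpow_zero, one_mul] at h1
  by_contra! hcon
  refine hT.not_ge (csInf_le ⟨0, fun _ h => h.1.le⟩ ⟨hT0, fun P hP a => ?_⟩)
  have hH : 0 ≤ ∑ i, ‖a i‖ ^ p := Finset.sum_nonneg fun i _ => by positivity
  rw [radLp_ofReal hp, lpnorm_ofReal hp]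
  have h1 : (∑ ε, |P.2 (signed ε a)| ^ p) / 2 ^ n ≤
      t ^ p * (n : ℝ) ^ (p - 1) * ∑ i, ‖a i‖ ^ p := by
    rw [div_le_iff₀ (by positivity)]
    simp only [abs_of_nonneg (apply_nonneg P.2 _)]
    linarith [hcon P hP a]
  refine (Real.rpow_le_rpow (div_nonneg (Finset.sum_nonneg fun _ _ => by positivity)
    (by positivity)) h1 (by positivity)).trans_eq ?_
  rw [Real.mul_rpow (by positivity) hH, Real.mul_rpow (by positivity) (by positivity),
    ← Real.rpow_mul ht.le, ← Real.rpow_mul hn'.le, mul_one_div_cancel hp0.ne', Real.rpow_one]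
  congr 3
  field_simp

end Constants

/-- Theorem 3.3, block subtype: for a stable set
`E ⊆ ⋃_{n≥1} B_n^{a,b}` the following are equivalent: block subtype `p` for all
`1 < p < ∞`; block subtype `p` for some `1 < p < ∞`; block subtype (`Θ_n(E) → 0`);
for every `ϱ > 0`, the absence of `ϱ`-`ℓ₁`-sequences in `E ∩ B_n^{a,b}` for all large `n`;
and the non-existence of `c > 0` such that `c·Id_{ℓ₁}` is block finitely representable
on `E`. -/
theorem block_subtype_tfae {𝕜 : Type*} [RCLike 𝕜]
    (ca cb : ℝ) (hca : 0 ≤ ca) (hcb : 1 ≤ cb)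
    (E : Fam 𝕜) (hE : StableFam ca cb E) :
    List.TFAE
      [∀ p : ℝ, 1 < p →
          Filter.Tendsto
            (fun n : ℕ => (n : ℝ) ^ (1 / p - 1) * tauC (ENNReal.ofReal p) E n)
            Filter.atTop (nhds 0),
        ∃ p : ℝ, 1 < p ∧
          Filter.Tendsto
            (fun n : ℕ => (n : ℝ) ^ (1 / p - 1) * tauC (ENNReal.ofReal p) E n)
            Filter.atTop (nhds 0),
        Filter.Tendsto (fun n : ℕ => bigThetaC E n) Filter.atTop (nhds 0),
        ∀ ϱ : ℝ, 0 < ϱ → ∃ N : ℕ, ∀ n : ℕ, N ≤ n → ∀ P ∈ E n, ¬ IsL1Seq ϱ P,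
        ¬ ∃ c : ℝ, 0 < c ∧ ∀ n : ℕ, 1 ≤ n → ∃ P ∈ E n,
            (∀ a : Fin n → 𝕜, P.1 a = ∑ i, ‖a i‖) ∧
            (∀ a : Fin n → 𝕜, P.2 a = c * ∑ i, ‖a i‖)] := by
  tfae_have 1 → 2 := fun h => ⟨2, one_lt_two, h 2 one_lt_two⟩
  tfae_have 2 → 3 := fun ⟨p, hp, h⟩ => squeeze_zero' (.of_forall fun _ => bigThetaC_nonneg)
    ((Filter.eventually_gt_atTop 0).mono fun _ hn => bigThetaC_le_tauC hE.1 hca hp hn) h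
  tfae_have 3 → 4 := by
    intro h ϱ hϱ
    obtain ⟨N, hN⟩ := Filter.eventually_atTop.1 (h.eventually_lt_const hϱ)
    refine ⟨N + 1, fun n hn P hP hl => (hN n (by omega)).not_ge ?_⟩
    exact hl.le_bigThetaC hE.1 hca (by omega) hP
  tfae_have 4 → 1 := by
    intro h p hp
    by_contra hcon
    obtain ⟨t, ht, hfreq⟩ : ∃ t : ℝ, 0 < t ∧ ∃ᶠ n : ℕ in Filter.atTop,
        t < (n : ℝ) ^ (1 / p - 1) * tauC (ENNReal.ofReal p) E n := by
      contrapose! hcon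
      refine tendsto_order.2 ⟨fun c hc => .of_forall fun n => hc.trans_le ?_, fun c hc => ?_⟩
      · exact mul_nonneg (by positivity) tauC_nonneg
      · filter_upwards [hcon (c / 2) (half_pos hc)] with n hn
        linarith
    obtain ⟨ϱ, hϱ, hlow⟩ := hE.exists_realL1Lower hca hp (Real.rpow_pos_of_pos ht p)
    have hreal : ∀ m, 0 < m → ∃ Q ∈ E m, RealL1Lower ϱ Q.2 := by
      intro m hm
      obtain ⟨N, hN⟩ := hlow m hm
      obtain ⟨n, hn, hlt⟩ := Filter.frequently_atTop.1 hfreq (N + 1)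
      obtain ⟨P, hP, a, ha⟩ := exists_sum_signed_gt_of_lt_tauC hp (by omega) ht hlt
      exact hN n (by omega) P hP a ha
    have hca' : 0 < ca := by
      obtain ⟨Q, hQ, hQl⟩ := hreal 1 one_pos
      have h1 := (hE.1 1 Q hQ).snd_le (ofRealVec fun _ => 1)
      have h2 := (hE.1 1 Q hQ).fst_le (ofRealVec fun _ => 1)
      have h3 := hQl fun _ => 1
      simp [ofRealVec] at h1 h2 h3
      nlinarith
    obtain ⟨N, hN⟩ := h (ϱ ^ 2 / (8 * ca)) (by positivity)
    obtain ⟨P, hP, hPl⟩ := hreal ((N + 1) * (N + 1)) (by positivity)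
    obtain ⟨Q, hQ, hQl⟩ := hE.exists_l1Lower_of_real hϱ N.succ_pos hP hPl
    exact hN (N + 1) (by omega) Q hQ hQl
  tfae_have 4 → 5 := by
    rintro h ⟨c, hc, hmem⟩
    obtain ⟨N, hN⟩ := h c hc
    obtain ⟨P, hP, -, hP2⟩ := hmem (N + 1) (by omega)
    exact hN (N + 1) (by omega) P hP fun a => (hP2 a).ge
  tfae_have 5 → 4 := by
    intro h ϱ hϱ
    by_contra! hcon
    obtain ⟨c, hc, hcca, hbounds⟩ := hE.exists_almost_isometric hϱ hcon
    refine h ⟨c, hc, fun n _ => ⟨_, hE.l1_mem hcb hc.le hcca fun ε hε => hbounds ε hε n, ?_, ?_⟩⟩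
    · intro a
      rw [l1Seminorm_apply, one_mul]
    · exact fun a => l1Seminorm_apply hc.le a
  tfae_finish

end AsymSeminorms
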